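/- arXiv:2310.18452 — 4 statements merged into one kernel-verified Lean document; each statement's English description precedes it below -/
import Mathlib

section
/- Let t ≥ s ≥ 2 be integers. There exist a constant c_s > 0 depending only on s and k₀ = k₀(s,t) such that for every integer k ≥ k₀ the following holds: if G is a graph on n vertices with n ≥ k^{100t} which has no induced subgraph isomorphic to the complete bipartite graph K_{s,t} and contains no clique on k vertices, then G has at least c_s · n^s independent sets of size s. -/
open Finset

/-- The average degree `2|E|/|V|` of a finite simple graph. -/
noncomputable def avgDeg {V : Type*} [Fintype V] (G : SimpleGraph V) : ℝ :=
  2 * G.edgeSet.ncard / Fintype.card V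

/-- The degree of a vertex. -/
noncomputable def deg {V : Type*} (G : SimpleGraph V) (v : V) : ℕ :=
  (G.neighborSet v).ncard

/-- `G` contains `K_{s,s}` as a (not necessarily induced) subgraph. -/
def HasKssSubgraph {V : Type*} (G : SimpleGraph V) (s : ℕ) : Prop :=
  ∃ f : completeBipartiteGraph (Fin s) (Fin s) →g G, Function.Injective f

/-- `G` contains no cycle of length 4, even as a non-induced subgraph. -/
def C4Free {V : Type*} (G : SimpleGraph V) : Prop :=
  ¬ ∃ a b c d : V, a ≠ b ∧ a ≠ c ∧ a ≠ d ∧ b ≠ c ∧ b ≠ d ∧ c ≠ d ∧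
      G.Adj a b ∧ G.Adj b c ∧ G.Adj c d ∧ G.Adj d a

/-- The balanced subdivision of `K_h` in which every edge of `K_h` is replaced by a
path with exactly `ℓ` edges (intended for `ℓ ≥ 2`): branch vertices are `Fin h`,
and each pair `a < b` gets a path of `ℓ - 1` new internal vertices. -/
def balancedSubdivision (h ℓ : ℕ) :
    SimpleGraph (Fin h ⊕ ({p : Fin h × Fin h // p.1 < p.2} × Fin (ℓ - 1))) :=
  SimpleGraph.fromRel (fun x y =>
    match x, y with
    | Sum.inl u, Sum.inr ⟨⟨⟨a, b⟩, _⟩, i⟩ => (u = a ∧ (i : ℕ) = 0) ∨ (u = b ∧ (i : ℕ) = ℓ - 2)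
    | Sum.inr ⟨e, i⟩, Sum.inr ⟨e', j⟩ => e = e' ∧ (j : ℕ) = (i : ℕ) + 1
    | _, _ => False)

/-- `G` contains an induced proper balanced subdivision of `K_h`. -/
def HasInducedBalancedSubdivision {V : Type*} (G : SimpleGraph V) (h : ℕ) : Prop :=
  ∃ ℓ : ℕ, 2 ≤ ℓ ∧ Nonempty (balancedSubdivision h ℓ ↪g G)

/-- The number of edges of `G` with one endpoint in `A` and the other in `B`
(for disjoint `A`, `B`). -/
noncomputable def crossEdges {V : Type*} (G : SimpleGraph V) (A B : Set V) : ℕ :=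
  Set.ncard {p : V × V | p.1 ∈ A ∧ p.2 ∈ B ∧ G.Adj p.1 p.2}

/-- `G` is `d`-degenerate: every (induced) subgraph has a vertex of degree at most `d`. -/
def Degenerate {V : Type*} (G : SimpleGraph V) (d : ℕ) : Prop :=
  ∀ s : Finset V, s.Nonempty → ∃ v ∈ s, ((s : Set V) ∩ G.neighborSet v).ncard ≤ d

/-- The 1-subdivision of the multihypergraph with hyperedges `edges e`, `e : E`,
on vertex set `V`. -/
def oneSubdivision {E V : Type*} (edges : E → Finset V) : SimpleGraph (E ⊕ V) :=
  SimpleGraph.fromRel (fun x y =>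
    match x, y with
    | Sum.inl a, Sum.inr b => b ∈ edges a
    | _, _ => False)

/-- The 1-subdivision of a simple graph `G`. -/
def graphOneSubdivision {W : Type*} (G : SimpleGraph W) : SimpleGraph (G.edgeSet ⊕ W) :=
  SimpleGraph.fromRel (fun x y =>
    match x, y with
    | Sum.inl e, Sum.inr w => w ∈ (e : Sym2 W)
    | _, _ => False)

/-- `I` is an independent set of `G`. -/
def IndepSet {V : Type*} (G : SimpleGraph V) (I : Set V) : Prop :=
  I.Pairwise fun u v => ¬ G.Adj u v

/-- `G` has a clique on `k` vertices. -/
def HasClique {V : Type*} (G : SimpleGraph V) (k : ℕ) : Prop :=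
  ∃ t : Finset V, G.IsNClique k t

/-- A quantitative form of Ramsey's theorem: `k ^ s` vertices force a clique of size `k` or an
independent set of size `s`. -/
theorem exists_isNClique_or_indepSet {V : Type*} (G : SimpleGraph V) (k s : ℕ) (U : Finset V)
    (hU : k ^ s ≤ #U) :
    (∃ A ⊆ U, G.IsNClique k A) ∨ ∃ A ⊆ U, #A = s ∧ IndepSet G (A : Set V) := by
  classical
  induction k generalizing s U with
  | zero => exact Or.inl ⟨∅, by simp, by simp⟩
  | succ k ihk =>
    induction s generalizing U with
    | zero => exact Or.inr ⟨∅, by simp, by simp, by simp [IndepSet]⟩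
    | succ s ihs =>
      have hpos : 0 < #U := lt_of_lt_of_le (by positivity) hU
      obtain ⟨v, hv⟩ := Finset.card_pos.mp hpos
      set N := (U.erase v).filter (G.Adj v) with hN
      set M := (U.erase v).filter (fun w => ¬ G.Adj v w) with hM
      have hNM : #N + #M = #U - 1 := by
        rw [hN, hM, Finset.card_filter_add_card_filter_not, Finset.card_erase_of_mem hv]
      have hNU : N ⊆ U := (Finset.filter_subset _ _).trans (Finset.erase_subset _ _)
      have hMU : M ⊆ U := (Finset.filter_subset _ _).trans (Finset.erase_subset _ _)
      have hpow : k ^ (s + 1) + (k + 1) ^ s ≤ (k + 1) ^ (s + 1) := by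
        have h : k ^ s ≤ (k + 1) ^ s := Nat.pow_le_pow_left (Nat.le_succ k) s
        calc k ^ (s + 1) + (k + 1) ^ s = k ^ s * k + (k + 1) ^ s := by rw [pow_succ]
          _ ≤ (k + 1) ^ s * k + (k + 1) ^ s := by gcongr
          _ = (k + 1) ^ (s + 1) := by ring
      by_cases hNc : k ^ (s + 1) ≤ #N
      · rcases ihk (s + 1) N hNc with ⟨A, hA, hcl⟩ | ⟨A, hA, h⟩
        · refine Or.inl ⟨insert v A, Finset.insert_subset hv (hA.trans hNU), hcl.insert ?_⟩
          intro b hb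
          exact (Finset.mem_filter.mp (hA hb)).2
        · exact Or.inr ⟨A, hA.trans hNU, h⟩
      · rcases ihs M (by omega) with ⟨A, hA, h⟩ | ⟨A, hA, hcard, hind⟩
        · exact Or.inl ⟨A, hA.trans hMU, h⟩
        · have hnot : ∀ w ∈ A, ¬ G.Adj v w := fun w hw => (Finset.mem_filter.mp (hA hw)).2
          have hvA : v ∉ A := fun h => by simpa [hM] using hA h
          refine Or.inr ⟨insert v A, Finset.insert_subset hv (hA.trans hMU), ?_, ?_⟩
          · rw [Finset.card_insert_of_notMem hvA, hcard]
          · rw [IndepSet, Finset.coe_insert]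
            refine Set.Pairwise.insert hind fun w hw _ => ⟨hnot w hw, fun h => hnot w hw h.symm⟩

/-- Two independent sets that are completely joined to each other span an induced complete
bipartite graph. -/
theorem nonempty_completeBipartiteGraph_embedding {V : Type*} (G : SimpleGraph V) {s t : ℕ}
    {A B : Finset V} (hA : #A = s) (hB : #B = t) (hAi : IndepSet G (A : Set V))
    (hBi : IndepSet G (B : Set V)) (hAB : ∀ a ∈ A, ∀ b ∈ B, G.Adj a b) :
    Nonempty (completeBipartiteGraph (Fin s) (Fin t) ↪g G) := by
  let e := (A.equivFinOfCardEq hA).symm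
  let f := (B.equivFinOfCardEq hB).symm
  have hnot : ∀ {I : Finset V}, IndepSet G (I : Set V) → ∀ x y : I, ¬ G.Adj x y :=
    fun hI x y h => hI x.2 y.2 h.ne h
  refine ⟨⟨⟨Sum.elim (fun i => (e i : V)) (fun j => (f j : V)), ?_⟩, ?_⟩⟩
  · refine Function.Injective.sumElim (Subtype.val_injective.comp e.injective)
      (Subtype.val_injective.comp f.injective) fun i j h => ?_
    exact (hAB _ (e i).2 _ (f j).2).ne h
  · rintro (i | i) (j | j)
    · simpa using hnot hAi (e i) (e j)
    · simpa using hAB _ (e i).2 _ (f j).2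
    · simpa using (hAB _ (e j).2 _ (f i).2).symm
    · simpa using hnot hBi (f i) (f j)

/-- Dependent random choice, in counting form: without large cliques and without an induced
`K_{s,t}`, few `r`-tuples of vertices can have a large common neighbourhood. -/
theorem sum_degree_pow_le {V : Type*} [Fintype V] (G : SimpleGraph V) [DecidableRel G.Adj]
    {s t k : ℕ} (r : ℕ) (hst : IsEmpty (completeBipartiteGraph (Fin s) (Fin t) ↪g G))
    (hk : ¬ HasClique G k) :
    ∑ v, G.degree v ^ r ≤
      Fintype.card V ^ r * k ^ s + Fintype.card V ^ s * (k ^ t) ^ r * Fintype.card V := by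
  classical
  set n := Fintype.card V with hn
  let U : (Fin r → V) → Finset V := fun x => univ.filter fun v => ∀ i, G.Adj v (x i)
  let W : Finset V → Finset V := fun y => univ.filter fun v => ∀ a ∈ y, G.Adj a v
  let Y : Finset (Finset V) := (powersetCard s univ).filter fun y => IndepSet G (y : Set V)
  let bad : Finset (Fin r → V) := Y.biUnion fun y => Fintype.piFinset fun _ => W y
  have hWcard : ∀ y ∈ Y, #(W y) ≤ k ^ t := by
    intro y hy
    obtain ⟨hy, hyi⟩ := Finset.mem_filter.mp hy
    by_contra! hlt
    rcases exists_isNClique_or_indepSet G k t (W y) hlt.le with ⟨A, -, hA⟩ | ⟨A, hAW, hA, hAi⟩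
    · exact hk ⟨A, hA⟩
    · exact not_isEmpty_iff.mpr (nonempty_completeBipartiteGraph_embedding G
        (Finset.mem_powersetCard.mp hy).2 hA hyi hAi fun a ha b hb =>
          (Finset.mem_filter.mp (hAW hb)).2 a ha) hst
  have hYcard : #Y ≤ n ^ s := by
    refine (Finset.card_filter_le _ _).trans ?_
    rw [Finset.card_powersetCard, Finset.card_univ]
    exact Nat.choose_le_pow _ _
  have hbad : #bad ≤ n ^ s * (k ^ t) ^ r := by
    refine (Finset.card_biUnion_le_card_mul Y _ ((k ^ t) ^ r) fun y hy => ?_).trans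
      (Nat.mul_le_mul_right _ hYcard)
    rw [Fintype.card_piFinset_const]
    exact Nat.pow_le_pow_left (hWcard y hy) r
  have hUcard : ∀ x, #(U x) ≤ k ^ s + if x ∈ bad then n else 0 := by
    intro x
    by_cases hx : x ∈ bad
    · rw [if_pos hx]
      exact (Finset.card_le_univ _).trans (Nat.le_add_left _ _)
    · rw [if_neg hx, add_zero]
      by_contra! hlt
      rcases exists_isNClique_or_indepSet G k s (U x) hlt.le with ⟨A, -, hA⟩ | ⟨A, hAU, hA, hAi⟩
      · exact hk ⟨A, hA⟩
      · refine hx (Finset.mem_biUnion.mpr ⟨A, ?_, ?_⟩)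
        · exact Finset.mem_filter.mpr
            ⟨Finset.mem_powersetCard.mpr ⟨Finset.subset_univ _, hA⟩, hAi⟩
        · refine Fintype.mem_piFinset.mpr fun i => Finset.mem_filter.mpr
            ⟨Finset.mem_univ _, fun a ha => (Finset.mem_filter.mp (hAU ha)).2 i⟩
  have hdouble : ∑ v, G.degree v ^ r = ∑ x, #(U x) := by
    have h := Finset.sum_card_bipartiteAbove_eq_sum_card_bipartiteBelow
      (s := (univ : Finset V)) (t := (univ : Finset (Fin r → V)))
      (fun v x => ∀ i, G.Adj v (x i))
    refine Eq.trans (Finset.sum_congr rfl fun v _ => ?_) h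
    rw [← G.card_neighborFinset_eq_degree v, ← Fintype.card_piFinset_const]
    congr 1
    ext x
    simp [Finset.bipartiteAbove]
  calc ∑ v, G.degree v ^ r = ∑ x, #(U x) := hdouble
    _ ≤ ∑ x, (k ^ s + if x ∈ bad then n else 0) := Finset.sum_le_sum fun x _ => hUcard x
    _ = n ^ r * k ^ s + #bad * n := by
      rw [Finset.sum_add_distrib, Finset.sum_ite_mem]
      simp [hn]
    _ ≤ n ^ r * k ^ s + n ^ s * (k ^ t) ^ r * n := by gcongr

/-- A relation with `p` pairs is met in two prescribed coordinates by at most `p * n ^ (s - 2)` of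
the `s`-tuples. -/
theorem card_filter_rel_apply_mul_sq_le {V : Type*} [Fintype V] [DecidableEq V] {s : ℕ}
    (R : V → V → Prop) [DecidableRel R] {i j : Fin s} (hij : i ≠ j) :
    #{f : Fin s → V | R (f i) (f j)} * Fintype.card V ^ 2 ≤
      #{p : V × V | R p.1 p.2} * Fintype.card V ^ s := by
  have hcard : #{f : Fin s → V | R (f i) (f j)} ≤
      #(({p : V × V | R p.1 p.2} : Finset (V × V)) ×ˢ
        (univ : Finset ({a : Fin s // a ∉ ({i, j} : Finset (Fin s))} → V))) := by
    refine Finset.card_le_card_of_injOn (fun f => ((f i, f j), fun a => f a)) ?_ ?_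
    · intro f hf
      simpa using hf
    · intro f _ g _ h
      simp only [Prod.mk.injEq] at h
      funext a
      by_cases ha : a ∈ ({i, j} : Finset (Fin s))
      · rcases Finset.mem_insert.mp ha with rfl | ha
        · exact h.1.1
        · rw [Finset.mem_singleton.mp ha]
          exact h.1.2
      · exact congrFun h.2 ⟨a, ha⟩
  have htwo : #({i, j} : Finset (Fin s)) = 2 := Finset.card_pair hij
  have hs : 2 ≤ s := by
    simpa [htwo] using Finset.card_le_univ ({i, j} : Finset (Fin s))
  have hcompl : Fintype.card {a : Fin s // a ∉ ({i, j} : Finset (Fin s))} = s - 2 := by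
    rw [Fintype.card_subtype_compl, Fintype.card_fin, Fintype.card_coe, htwo]
  rw [Finset.card_product, Finset.card_univ, Fintype.card_fun, hcompl] at hcard
  calc _ ≤ #{p : V × V | R p.1 p.2} * Fintype.card V ^ (s - 2) * Fintype.card V ^ 2 := by gcongr
    _ = _ := by rw [mul_assoc, ← pow_add, Nat.sub_add_cancel hs]

/-- A graph with few edges has many independent sets of size `s`. -/
theorem card_pow_le_ncard_indepSet {V : Type*} [Fintype V] [DecidableEq V] (G : SimpleGraph V)
    [DecidableRel G.Adj] (s : ℕ)
    (hR : 2 * s ^ 2 * #{p : V × V | p.1 = p.2 ∨ G.Adj p.1 p.2} ≤ Fintype.card V ^ 2)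
    (hV : 0 < Fintype.card V) :
    Fintype.card V ^ s ≤
      2 * (s ^ s * Set.ncard {I : Finset V | #I = s ∧ IndepSet G (I : Set V)}) := by
  classical
  set n := Fintype.card V with hn
  let R : V → V → Prop := fun u v => u = v ∨ G.Adj u v
  set p := #{p : V × V | p.1 = p.2 ∨ G.Adj p.1 p.2}
  let bad : Finset (Fin s → V) :=
    ((univ : Finset (Fin s)).offDiag).biUnion fun q => {f | R (f q.1) (f q.2)}
  let F : Finset (Finset V) := univ.filter fun I => #I = s ∧ IndepSet G (I : Set V)
  have hF : Set.ncard {I : Finset V | #I = s ∧ IndepSet G (I : Set V)} = #F := by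
    rw [← Set.ncard_coe_finset]
    simp [F]
  have hbad : #bad * n ^ 2 ≤ s ^ 2 * (p * n ^ s) := by
    calc #bad * n ^ 2
        ≤ (∑ q ∈ (univ : Finset (Fin s)).offDiag,
            #{f : Fin s → V | R (f q.1) (f q.2)}) * n ^ 2 := by
          gcongr
          exact Finset.card_biUnion_le
      _ = ∑ q ∈ (univ : Finset (Fin s)).offDiag,
            #{f : Fin s → V | R (f q.1) (f q.2)} * n ^ 2 := Finset.sum_mul _ _ _
      _ ≤ ∑ _q ∈ (univ : Finset (Fin s)).offDiag, p * n ^ s :=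
          Finset.sum_le_sum fun q hq =>
            card_filter_rel_apply_mul_sq_le R (Finset.mem_offDiag.mp hq).2.2
      _ = #(univ : Finset (Fin s)).offDiag * (p * n ^ s) := by simp
      _ ≤ s ^ 2 * (p * n ^ s) := by
          gcongr
          rw [Finset.offDiag_card, Finset.card_univ, Fintype.card_fin, sq]
          exact Nat.sub_le _ _
  have hhalf : 2 * #bad ≤ n ^ s := by
    refine Nat.le_of_mul_le_mul_right ?_ (show 0 < n ^ 2 by positivity)
    calc 2 * #bad * n ^ 2 = 2 * (#bad * n ^ 2) := by ring
      _ ≤ 2 * (s ^ 2 * (p * n ^ s)) := by gcongr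
      _ = 2 * s ^ 2 * p * n ^ s := by ring
      _ ≤ n ^ 2 * n ^ s := by gcongr
      _ = n ^ s * n ^ 2 := by ring
  have hgood : #badᶜ ≤ s ^ s * #F := by
    have hnot : ∀ f ∈ badᶜ, ∀ i j, i ≠ j → ¬ R (f i) (f j) := by
      intro f hf i j hij h
      refine Finset.mem_compl.mp hf (Finset.mem_biUnion.mpr ⟨(i, j), ?_, ?_⟩)
      · simpa using hij
      · simpa using h
    refine Finset.card_le_mul_card_image_of_maps_to (f := fun f => univ.image f) ?_ (s ^ s) ?_
    · intro f hf
      have hinj : Function.Injective f := fun i j h => by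
        by_contra hij
        exact hnot f hf i j hij (Or.inl h)
      refine Finset.mem_filter.mpr ⟨Finset.mem_univ _, ?_, ?_⟩
      · rw [Finset.card_image_of_injective _ hinj, Finset.card_univ, Fintype.card_fin]
      · intro u hu v hv huv hadj
        simp only [Finset.coe_image, Finset.coe_univ, Set.image_univ, Set.mem_range] at hu hv
        obtain ⟨i, rfl⟩ := hu
        obtain ⟨j, rfl⟩ := hv
        exact hnot f hf i j (fun h => huv (congrArg f h)) (Or.inr hadj)
    · intro I hI
      have hIc : #I = s := (Finset.mem_filter.mp hI).2.1
      calc _ ≤ #(Fintype.piFinset fun _ : Fin s => I) := by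
            refine Finset.card_le_card fun f hf => Fintype.mem_piFinset.mpr fun i => ?_
            rw [← (Finset.mem_filter.mp hf).2]
            exact Finset.mem_image_of_mem f (Finset.mem_univ i)
        _ = s ^ s := by rw [Fintype.card_piFinset_const, hIc]
  have htotal : #bad + #badᶜ = n ^ s := by
    rw [Finset.card_add_card_compl, Fintype.card_fun, Fintype.card_fin]
  rw [hF]
  omega

/-- A graph on many vertices without large cliques and without an induced `K_{s,t}` is sparse. -/
theorem sum_degree_le_of_isEmpty_embedding {V : Type*} [Fintype V] (G : SimpleGraph V)
    [DecidableRel G.Adj] {s t k a : ℕ} (hs : 1 ≤ s) (hst : s ≤ t)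
    (ha : 2 * a ^ (2 * s) ≤ k) (hk : 1 ≤ k) (hn : k ^ (100 * t) ≤ Fintype.card V)
    (hind : IsEmpty (completeBipartiteGraph (Fin s) (Fin t) ↪g G)) (hcl : ¬ HasClique G k) :
    a * ∑ v, G.degree v ≤ Fintype.card V ^ 2 := by
  have hub := sum_degree_pow_le G (2 * s) hind hcl
  set n := Fintype.card V
  set D := ∑ v, G.degree v
  have hnpos : 0 < n := lt_of_lt_of_le (by positivity) hn
  have hmean : D ^ (2 * s) ≤ n ^ (2 * s - 1) * ∑ v, G.degree v ^ (2 * s) := by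
    obtain ⟨m, hm⟩ : ∃ m, 2 * s = m + 1 := ⟨2 * s - 1, by omega⟩
    rw [hm, Nat.add_sub_cancel]
    exact pow_sum_le_card_mul_sum_pow (fun v _ => Nat.zero_le _) m
  have hfirst : k * k ^ s ≤ n := by
    rw [← pow_succ']
    exact (Nat.pow_le_pow_right hk (by omega)).trans hn
  have hsecond : k * (k ^ t) ^ (2 * s) ≤ n ^ s := by
    calc k * (k ^ t) ^ (2 * s) = k ^ (t * (2 * s) + 1) := by rw [← pow_mul, ← pow_succ']
      _ ≤ k ^ (100 * t * s) := Nat.pow_le_pow_right hk (by nlinarith)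
      _ = (k ^ (100 * t)) ^ s := pow_mul _ _ _
      _ ≤ n ^ s := Nat.pow_le_pow_left hn s
  have hsum : k * ∑ v, G.degree v ^ (2 * s) ≤ 2 * n ^ (2 * s + 1) := by
    calc k * ∑ v, G.degree v ^ (2 * s)
        ≤ k * (n ^ (2 * s) * k ^ s + n ^ s * (k ^ t) ^ (2 * s) * n) := by gcongr
      _ = n ^ (2 * s) * (k * k ^ s) + n ^ s * (k * (k ^ t) ^ (2 * s)) * n := by ring
      _ ≤ n ^ (2 * s) * n + n ^ s * n ^ s * n := by gcongr
      _ = 2 * n ^ (2 * s + 1) := by ring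
  have hpow : k * D ^ (2 * s) ≤ 2 * (n ^ 2) ^ (2 * s) := by
    calc k * D ^ (2 * s) ≤ k * (n ^ (2 * s - 1) * ∑ v, G.degree v ^ (2 * s)) := by gcongr
      _ = n ^ (2 * s - 1) * (k * ∑ v, G.degree v ^ (2 * s)) := by ring
      _ ≤ n ^ (2 * s - 1) * (2 * n ^ (2 * s + 1)) := by gcongr
      _ = 2 * n ^ (2 * s - 1 + (2 * s + 1)) := by rw [pow_add]; ring
      _ = 2 * (n ^ 2) ^ (2 * s) := by rw [← pow_mul]; congr 2; omega
  refine le_of_pow_le_pow_left₀ (n := 2 * s) (by omega) (Nat.zero_le _) ?_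
  refine Nat.le_of_mul_le_mul_left ?_ two_pos
  calc 2 * (a * D) ^ (2 * s) = 2 * a ^ (2 * s) * D ^ (2 * s) := by rw [mul_pow]; ring
    _ ≤ k * D ^ (2 * s) := by gcongr
    _ ≤ 2 * (n ^ 2) ^ (2 * s) := hpow

/-- Supersaturation: for `t ≥ s ≥ 2` there are `c_s > 0` and `k₀(s,t)`
such that for `k ≥ k₀`, every `K_k`-free graph on `n ≥ k^(100t)` vertices with no induced
`K_{s,t}` has at least `c_s n^s` independent sets of size `s`. -/
theorem stmt4 :
    ∀ s : ℕ, 2 ≤ s → ∃ c : ℝ, 0 < c ∧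
      ∀ t : ℕ, s ≤ t → ∃ k₀ : ℕ, ∀ k : ℕ, k₀ ≤ k →
        ∀ (V : Type) [Fintype V] (G : SimpleGraph V),
          Fintype.card V ≥ k ^ (100 * t) →
          IsEmpty (completeBipartiteGraph (Fin s) (Fin t) ↪g G) →
          ¬ HasClique G k →
          ((Set.ncard {I : Finset V | I.card = s ∧ IndepSet G (I : Set V)}) : ℝ)
            ≥ c * (Fintype.card V : ℝ) ^ s := by
  classical
  intro s hs
  refine ⟨1 / (2 * s ^ s), by positivity, fun t hst =>
    ⟨2 * (4 * s ^ 2) ^ (2 * s) + 4 * s ^ 2, fun k hk V _ G hn hind hcl => ?_⟩⟩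
  have hs2 : 0 < 4 * s ^ 2 := by positivity
  have hk1 : 1 ≤ k := by omega
  have hkn : k ≤ Fintype.card V := (Nat.le_self_pow (by omega) k).trans hn
  have hsparse := sum_degree_le_of_isEmpty_embedding G (a := 4 * s ^ 2) (by omega) hst (by omega)
    hk1 hn hind hcl
  have hpairs : #{p : V × V | p.1 = p.2 ∨ G.Adj p.1 p.2} ≤
      Fintype.card V + ∑ v, G.degree v := by
    rw [Finset.filter_or]
    refine (Finset.card_union_le _ _).trans (Nat.add_le_add ?_ ?_)
    · refine Finset.card_le_card_of_injOn (t := univ) Prod.fst (by simp) ?_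
      rintro ⟨u, v⟩ h ⟨u', v'⟩ h' rfl
      simp_all
    · rw [Finset.card_filter, Fintype.sum_prod_type]
      refine (Finset.sum_congr rfl fun v _ => ?_).le
      rw [← Finset.card_filter, ← G.card_neighborFinset_eq_degree, G.neighborFinset_eq_filter]
  have hdiag : 4 * s ^ 2 * Fintype.card V ≤ Fintype.card V ^ 2 := by
    rw [sq (Fintype.card V)]
    exact Nat.mul_le_mul_right _ (by omega)
  have hfew : 2 * s ^ 2 * #{p : V × V | p.1 = p.2 ∨ G.Adj p.1 p.2} ≤ Fintype.card V ^ 2 := by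
    linarith [Nat.mul_le_mul_left (2 * s ^ 2) hpairs]
  have hcount := card_pow_le_ncard_indepSet G s hfew (by omega)
  have hcast : (Fintype.card V : ℝ) ^ s ≤
      2 * (s ^ s * (Set.ncard {I : Finset V | #I = s ∧ IndepSet G (I : Set V)} : ℝ)) := by
    exact_mod_cast hcount
  rw [ge_iff_le, div_mul_eq_mul_div, one_mul, div_le_iff₀ (by positivity)]
  linarith
end

section
/- Fix integers t ≥ s ≥ 2. There exists k₀ = k₀(s,t) such that for every integer k ≥ k₀ the following holds: if G is a graph on n vertices with average degree d(G) ≥ n^{1 − 1/(100s)} and n ≥ k^{100t}, then G contains either a clique on k vertices or an induced subgraph isomorphic to the complete bipartite graph K_{s,t}. -/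
open Finset

/-- In a finset with at least `k ^ s` vertices there is a `k`-clique or an independent `s`-set. -/
theorem hasClique_or_exists_indepSet {V : Type*} (G : SimpleGraph V) (k : ℕ) :
    ∀ (s : ℕ) (A : Finset V), k ^ s ≤ #A →
      HasClique G k ∨ ∃ S ⊆ A, #S = s ∧ IndepSet G (S : Set V) := by
  classical
  intro s
  induction s with
  | zero => exact fun A _ => .inr ⟨∅, by simp, by simp, by simp [IndepSet]⟩
  | succ s ih =>
    intro A hA
    by_cases hc : HasClique G k
    · exact .inl hc
    right
    have hlt : ∀ Q : Finset V, G.IsClique (Q : Set V) → #Q < k := by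
      intro Q hQ
      by_contra! h
      obtain ⟨R, hRQ, hR⟩ := exists_subset_card_eq h
      exact hc ⟨R, hQ.subset (by exact_mod_cast hRQ), hR⟩
    have hk : 0 < k := by simpa using hlt ∅ (by simp)
    obtain ⟨Q, hQ, hmax⟩ := exists_max_image
      (A.powerset.filter fun Q : Finset V => G.IsClique (Q : Set V)) card ⟨∅, by simp⟩
    simp only [mem_filter, mem_powerset] at hQ hmax
    have hcover : A ⊆ Q.biUnion fun q => insert q (A.filter fun v => v ≠ q ∧ ¬ G.Adj q v) := by
      intro v hv
      by_contra! hnot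
      simp only [mem_biUnion, mem_insert, mem_filter, not_exists, not_and, not_or] at hnot
      have hvQ : v ∉ Q := fun h => (hnot v h).1 rfl
      have hclique : G.IsClique ((insert v Q : Finset V) : Set V) := by
        rw [coe_insert, SimpleGraph.isClique_insert]
        refine ⟨hQ.2, fun q hq hne => ?_⟩
        have := (hnot q hq).2 hv hne
        exact (not_not.1 this).symm
      have := hmax (insert v Q) ⟨insert_subset hv hQ.1, hclique⟩
      rw [card_insert_of_notMem hvQ] at this
      omega
    obtain ⟨q, hq, hbig⟩ : ∃ q ∈ Q, k ^ s ≤ #(A.filter fun v => v ≠ q ∧ ¬ G.Adj q v) := by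
      by_contra! hsmall
      have h₁ : #A ≤ #Q * k ^ s := (card_le_card hcover).trans <|
        card_biUnion_le_card_mul _ _ _ fun q hq =>
          (card_insert_le _ _).trans (hsmall q hq)
      have h₂ : #Q * k ^ s < k * k ^ s :=
        Nat.mul_lt_mul_of_pos_right (hlt Q hQ.2) (by positivity)
      rw [pow_succ'] at hA
      omega
    obtain ⟨S, hSA, hS, hind⟩ := (ih _ hbig).resolve_left hc
    have hSq : ∀ v ∈ S, v ∈ A ∧ v ≠ q ∧ ¬ G.Adj q v := fun v hv => by
      simpa using hSA hv
    refine ⟨insert q S, ?_, ?_, ?_⟩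
    · exact insert_subset (hQ.1 hq) fun v hv => (hSq v hv).1
    · rw [card_insert_of_notMem fun h => (hSq q h).2.1 rfl, hS]
    · rw [IndepSet, coe_insert]
      refine hind.insert fun v hv _ => ⟨(hSq v hv).2.2, fun h => (hSq v hv).2.2 h.symm⟩

/-- Two independent sets that are completely joined span an induced complete bipartite graph. -/
theorem nonempty_completeBipartiteGraph_embedding_s5 {V : Type*} (G : SimpleGraph V) {s t : ℕ}
    {S T : Finset V} (hS : #S = s) (hT : #T = t) (hSi : IndepSet G (S : Set V))
    (hTi : IndepSet G (T : Set V)) (hST : ∀ v ∈ S, ∀ w ∈ T, G.Adj v w) :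
    Nonempty (completeBipartiteGraph (Fin s) (Fin t) ↪g G) := by
  have hSi' : ∀ v ∈ S, ∀ w ∈ S, ¬ G.Adj v w := fun v hv w hw h => hSi hv hw h.ne h
  have hTi' : ∀ v ∈ T, ∀ w ∈ T, ¬ G.Adj v w := fun v hv w hw h => hTi hv hw h.ne h
  let e := (S.equivFinOfCardEq hS).symm
  let f := (T.equivFinOfCardEq hT).symm
  refine ⟨⟨⟨Sum.elim (fun i => (e i : V)) (fun j => (f j : V)), ?_⟩, ?_⟩⟩
  · refine Function.Injective.sumElim (Subtype.val_injective.comp e.injective)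
      (Subtype.val_injective.comp f.injective) fun i j => ?_
    exact (hST _ (e i).2 _ (f j).2).ne
  · rintro (i | i) (j | j)
    · simpa using hSi' _ (e i).2 _ (e j).2
    · simpa using hST _ (e i).2 _ (f j).2
    · simpa using (hST _ (e j).2 _ (f i).2).symm
    · simpa using hTi' _ (f i).2 _ (f j).2

open Classical in
/-- Dependent random choice: if every independent `s`-set has at most `m` common neighbours and
every vertex set of size `R` contains an independent `s`-set, then the degrees are small on
average. -/
theorem sum_degree_pow_le_s5 {V : Type*} [Fintype V] (G : SimpleGraph V) (r s m R : ℕ)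
    (hR : ∀ A : Finset V, R ≤ #A → ∃ S ⊆ A, #S = s ∧ IndepSet G (S : Set V))
    (hm : ∀ S : Finset V, #S = s → IndepSet G (S : Set V) →
      #(univ.filter fun w => ∀ v ∈ S, G.Adj v w) ≤ m) :
    ∑ v, G.degree v ^ r ≤
      R * Fintype.card V ^ r + Fintype.card V * (Fintype.card V ^ s * m ^ r) := by
  set n := Fintype.card V
  let U : (Fin r → V) → Finset V := fun x => univ.filter fun v => ∀ i, G.Adj v (x i)
  have hsum : ∑ v, G.degree v ^ r = ∑ x, #(U x) := by
    have h := sum_card_bipartiteAbove_eq_sum_card_bipartiteBelow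
      (s := (univ : Finset V)) (t := (univ : Finset (Fin r → V)))
      (fun v x => ∀ i, G.Adj v (x i))
    refine Eq.trans (sum_congr rfl fun v _ => ?_) h
    rw [← SimpleGraph.card_neighborFinset_eq_degree, ← Fintype.card_piFinset_const]
    congr 1
    ext x
    simp [bipartiteAbove, Fintype.mem_piFinset]
  let B : Finset (Fin r → V) := univ.filter fun x => R ≤ #(U x)
  have hB : #B ≤ n ^ s * m ^ r := by
    let I := (powersetCard s (univ : Finset V)).filter fun S : Finset V => IndepSet G (S : Set V)
    have hsub : B ⊆ I.biUnion fun S => Fintype.piFinset fun _ : Fin r =>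
        univ.filter fun w => ∀ v ∈ S, G.Adj v w := by
      intro x hx
      obtain ⟨S, hSU, hS, hind⟩ := hR (U x) (mem_filter.1 hx).2
      simp only [mem_biUnion, Fintype.mem_piFinset, mem_filter, mem_univ, true_and]
      refine ⟨S, by simp [I, hS, hind], fun i v hv => ?_⟩
      exact (mem_filter.1 (hSU hv)).2 i
    have hI : #I ≤ n ^ s := by
      refine (card_filter_le _ _).trans ?_
      rw [card_powersetCard, card_univ]
      exact Nat.choose_le_pow _ _
    refine (card_le_card hsub).trans <| (card_biUnion_le_card_mul _ _ (m ^ r) ?_).trans <|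
      Nat.mul_le_mul_right _ hI
    intro S hS
    simp only [I, mem_filter, mem_powersetCard, subset_univ, true_and] at hS
    rw [Fintype.card_piFinset_const]
    exact Nat.pow_le_pow_left (hm S hS.1 hS.2) r
  calc ∑ v, G.degree v ^ r = ∑ x, #(U x) := hsum
    _ ≤ ∑ x, (R + if x ∈ B then n else 0) := by
      refine sum_le_sum fun x _ => ?_
      split_ifs with h
      · exact (card_le_univ _).trans (Nat.le_add_left _ _)
      · have : ¬ R ≤ #(U x) := fun h' => h (by simp [B, h'])
        omega
    _ = R * n ^ r + n * #B := by
      rw [sum_add_distrib, sum_ite_mem]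
      simp [n, mul_comm]
    _ ≤ _ := by gcongr

open Classical in
/-- Power mean inequality for the degree sequence. -/
theorem card_mul_avgDeg_pow_le {V : Type*} [Fintype V] [Nonempty V] (G : SimpleGraph V) (r : ℕ) :
    Fintype.card V * avgDeg G ^ r ≤ ∑ v, (G.degree v : ℝ) ^ r := by
  have hn : (0 : ℝ) < Fintype.card V := by exact_mod_cast Fintype.card_pos
  have havg : avgDeg G = ∑ v, (Fintype.card V : ℝ)⁻¹ * G.degree v := by
    rw [← mul_sum, ← Nat.cast_sum, G.sum_degrees_eq_twice_card_edges, avgDeg,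
      Set.ncard_eq_toFinset_card', SimpleGraph.edgeFinset]
    push_cast
    field_simp
  have h := Real.pow_arith_mean_le_arith_mean_pow univ (fun _ : V => (Fintype.card V : ℝ)⁻¹)
    (fun v => (G.degree v : ℝ)) (fun _ _ => by positivity)
    (by simp) (fun _ _ => by positivity) r
  rw [← havg, ← mul_sum] at h
  rwa [← le_inv_mul_iff₀ hn]

/-- For `t ≥ s ≥ 2` and all sufficiently large `k`: a graph on
`n ≥ k^(100t)` vertices with average degree at least `n^(1 - 1/(100 s))` contains a
`k`-clique or an induced `K_{s,t}`. -/
theorem stmt5 :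
    ∀ s t : ℕ, 2 ≤ s → s ≤ t → ∃ k₀ : ℕ, ∀ k : ℕ, k₀ ≤ k →
      ∀ (V : Type) [Fintype V] (G : SimpleGraph V),
        avgDeg G ≥ (Fintype.card V : ℝ) ^ ((1 : ℝ) - 1 / (100 * (s : ℝ))) →
        Fintype.card V ≥ k ^ (100 * t) →
        HasClique G k ∨ Nonempty (completeBipartiteGraph (Fin s) (Fin t) ↪g G) := by
  classical
  intro s t hs hst
  refine ⟨2, fun k hk V _ G hd hn => ?_⟩
  by_contra! hcon
  obtain ⟨hclique, hemb⟩ := hcon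
  set n := Fintype.card V with hn_def
  have hnpos : 0 < n := lt_of_lt_of_le (by positivity) hn
  have : Nonempty V := Fintype.card_pos_iff.1 hnpos
  have hdeg := sum_degree_pow_le_s5 G (2 * s) s (k ^ t) (k ^ s)
    (fun A hA => (hasClique_or_exists_indepSet G k s A hA).resolve_left hclique) (by
      intro S hS hSi
      by_contra! hbig
      obtain ⟨T, hTS, hT, hTi⟩ :=
        (hasClique_or_exists_indepSet G k t _ hbig.le).resolve_left hclique
      obtain ⟨e⟩ := nonempty_completeBipartiteGraph_embedding_s5 G hS hT hSi hTi
        fun v hv w hw => (mem_filter.1 (hTS hw)).2 v hv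
      exact hemb.false e)
  have hmean := card_mul_avgDeg_pow_le G (2 * s)
  rw [← hn_def] at hdeg hmean
  have hdeg' : (∑ v, (G.degree v : ℝ) ^ (2 * s)) ≤
      (k : ℝ) ^ s * (n : ℝ) ^ (2 * s) + n * ((n : ℝ) ^ s * ((k : ℝ) ^ t) ^ (2 * s)) := by
    exact_mod_cast hdeg
  have hn0 : (0 : ℝ) < n := by exact_mod_cast hnpos
  obtain ⟨x, hx0, hxn⟩ : ∃ x : ℝ, 0 < x ∧ x = (n : ℝ) ^ (1 / 100 : ℝ) :=
    ⟨_, Real.rpow_pos_of_pos hn0 _, rfl⟩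
  have hx100 : x ^ 100 = n := by
    rw [hxn, ← Real.rpow_natCast, ← Real.rpow_mul hn0.le]
    norm_num
  have hkx : (k : ℝ) ^ t ≤ x := by
    refine le_of_pow_le_pow_left₀ (n := 100) (by norm_num) hx0.le ?_
    rw [hx100, ← pow_mul, mul_comm t]
    exact_mod_cast hn
  have hk1 : (2 : ℝ) ≤ k := by exact_mod_cast hk
  have hkst : (k : ℝ) ^ s ≤ x := (pow_le_pow_right₀ (by linarith) hst).trans hkx
  have hx2 : 2 ≤ x := by
    refine le_trans ?_ hkx
    exact hk1.trans (le_self_pow₀ (by linarith) (by omega))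
  have hdpow : (n : ℝ) ^ (2 * s) ≤ x ^ 2 * avgDeg G ^ (2 * s) := by
    have h₁ : ((n : ℝ) ^ ((1 : ℝ) - 1 / (100 * (s : ℝ)))) ^ (2 * s) ≤ avgDeg G ^ (2 * s) :=
      pow_le_pow_left₀ (by positivity) hd _
    refine le_trans (le_of_eq ?_) (mul_le_mul_of_nonneg_left h₁ (by positivity))
    have hs0 : (s : ℝ) ≠ 0 := by positivity
    rw [hxn, ← Real.rpow_natCast, ← Real.rpow_natCast, ← Real.rpow_natCast,
      ← Real.rpow_mul hn0.le, ← Real.rpow_mul hn0.le, ← Real.rpow_add hn0]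
    congr 1
    push_cast
    field_simp
    ring
  have hlow : (n : ℝ) * ((n : ℝ) ^ s * ((k : ℝ) ^ t) ^ (2 * s)) ≤ (n : ℝ) ^ (2 * s) := by
    have hpow : ((k : ℝ) ^ t) ^ (2 * s) ≤ (n : ℝ) ^ (s - 1) := by
      refine (pow_le_pow_left₀ (by positivity) hkx _).trans ?_
      rw [← hx100, ← pow_mul]
      exact pow_le_pow_right₀ (by linarith) (by omega)
    calc (n : ℝ) * ((n : ℝ) ^ s * ((k : ℝ) ^ t) ^ (2 * s))
        ≤ (n : ℝ) * ((n : ℝ) ^ s * (n : ℝ) ^ (s - 1)) := by gcongr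
      _ = (n : ℝ) ^ (2 * s) := by
        rw [← pow_add, ← pow_succ']
        congr 1
        omega
  have hN : (0 : ℝ) < (n : ℝ) ^ (2 * s) := by positivity
  have hchain : (n : ℝ) * (n : ℝ) ^ (2 * s) ≤ x ^ 2 * (x + 1) * (n : ℝ) ^ (2 * s) := by
    calc (n : ℝ) * (n : ℝ) ^ (2 * s) ≤ n * (x ^ 2 * avgDeg G ^ (2 * s)) := by gcongr
      _ = x ^ 2 * (n * avgDeg G ^ (2 * s)) := by ring
      _ ≤ x ^ 2 * (x * (n : ℝ) ^ (2 * s) + (n : ℝ) ^ (2 * s)) := by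
        gcongr
        refine (hmean.trans hdeg').trans (add_le_add ?_ hlow)
        gcongr
      _ = _ := by ring
  have hfin := le_of_mul_le_mul_right hchain hN
  have hx4 : x ^ 4 ≤ n := by
    rw [← hx100]
    exact pow_le_pow_right₀ (by linarith) (by norm_num)
  nlinarith [pow_pos hx0 2, mul_pos hx0 hx0]
end

section
/- Let Γ = (A, B, E) be an L-almost-biregular bipartite graph, i.e. d_Γ(a) ≤ L|E|/|A| for all a ∈ A and d_Γ(b) ≤ L|E|/|B| for all b ∈ B. Then Γ has an induced subgraph Γ' with average degree d(Γ') ≥ d(Γ)/4 and maximum degree Δ(Γ') ≤ 24·L·d(Γ'). -/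
open Finset

/-- The number of neighbours of `v` inside `S`. -/
noncomputable def degInto {V : Type*} (G : SimpleGraph V) (S : Finset V) (v : V) : ℕ :=
  ({x : V | x ∈ S ∧ G.Adj x v}).ncard

open Classical in
lemma degInto_eq_card_filter {V : Type*} (G : SimpleGraph V) (S : Finset V) (v : V) :
    degInto G S v = #{x ∈ S | G.Adj x v} := by
  rw [degInto, ← Set.ncard_coe_finset]
  congr 1
  ext x
  simp

lemma degInto_univ {V : Type*} [Fintype V] (G : SimpleGraph V) (v : V) :
    degInto G univ v = deg G v := by
  rw [degInto, deg]
  congr 1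
  ext x
  simp [G.adj_comm]

lemma degInto_mono {V : Type*} (G : SimpleGraph V) {S T : Finset V} (h : S ⊆ T) (v : V) :
    degInto G S v ≤ degInto G T v := by
  classical
  rw [degInto_eq_card_filter, degInto_eq_card_filter]
  exact card_le_card (filter_subset_filter _ h)

lemma degInto_union_of_forall_not_adj {V : Type*} [DecidableEq V] (G : SimpleGraph V)
    (S T : Finset V) (v : V) (h : ∀ x ∈ T, ¬ G.Adj x v) :
    degInto G (S ∪ T) v = degInto G S v := by
  rw [degInto, degInto]
  congr 1
  ext x
  simp only [Set.mem_ofPred_eq, mem_union]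
  exact ⟨fun ⟨hx, ha⟩ => ⟨hx.resolve_right fun hT => h x hT ha, ha⟩,
    fun ⟨hx, ha⟩ => ⟨Or.inl hx, ha⟩⟩

lemma deg_induce {V : Type*} (G : SimpleGraph V) (s : Finset V) (v : (s : Set V)) :
    deg (G.induce (s : Set V)) v = degInto G s v := by
  rw [deg, degInto, ← Set.ncard_image_of_injective _ Subtype.val_injective]
  congr 1
  ext x
  simp [G.adj_comm, and_comm]

lemma two_mul_ncard_edgeSet {V : Type*} [Fintype V] (G : SimpleGraph V) :
    2 * G.edgeSet.ncard = ∑ v, deg G v := by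
  classical
  rw [← SimpleGraph.coe_edgeFinset, Set.ncard_coe_finset, ← G.sum_degrees_eq_twice_card_edges]
  refine sum_congr rfl fun v _ => ?_
  rw [← G.card_neighborFinset_eq_degree, ← Set.ncard_coe_finset, G.coe_neighborFinset, deg]

lemma sum_degInto_comm {V : Type*} (G : SimpleGraph V) (S T : Finset V) :
    ∑ v ∈ S, degInto G T v = ∑ v ∈ T, degInto G S v := by
  classical
  simp_rw [degInto_eq_card_filter, card_filter]
  rw [sum_comm]
  simp_rw [G.adj_comm]

/-- Twice the number of edges between two independent sets, counted over all their vertices. -/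
lemma sum_degInto_union {V : Type*} [DecidableEq V] (G : SimpleGraph V) {S T : Finset V}
    (hd : Disjoint S T) (hS : ∀ x ∈ S, ∀ y ∈ S, ¬ G.Adj x y)
    (hT : ∀ x ∈ T, ∀ y ∈ T, ¬ G.Adj x y) :
    ∑ v ∈ S ∪ T, degInto G (S ∪ T) v = 2 * ∑ v ∈ T, degInto G S v := by
  rw [sum_union hd, two_mul]
  congr 1
  · rw [← sum_degInto_comm G S T]
    refine sum_congr rfl fun v hv => ?_
    rw [union_comm, degInto_union_of_forall_not_adj]
    exact fun x hx => hS x hx v hv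
  · refine sum_congr rfl fun v hv => ?_
    rw [degInto_union_of_forall_not_adj]
    exact fun x hx => hT x hx v hv

lemma avgDeg_induce_union {V : Type*} [DecidableEq V] (G : SimpleGraph V) {S T : Finset V}
    (hd : Disjoint S T) (hS : ∀ x ∈ S, ∀ y ∈ S, ¬ G.Adj x y)
    (hT : ∀ x ∈ T, ∀ y ∈ T, ¬ G.Adj x y) :
    avgDeg (G.induce ((S ∪ T : Finset V) : Set V)) =
      2 * ((∑ v ∈ T, degInto G S v : ℕ) : ℝ) / ((#S : ℝ) + #T) := by
  have h : 2 * (G.induce ((S ∪ T : Finset V) : Set V)).edgeSet.ncard =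
      2 * ∑ v ∈ T, degInto G S v := by
    rw [two_mul_ncard_edgeSet, ← sum_degInto_union G hd hS hT, ← sum_coe_sort (S ∪ T)]
    exact sum_congr rfl fun v _ => deg_induce G _ v
  have h' := congrArg (Nat.cast (R := ℝ)) h
  rw [Nat.cast_mul, Nat.cast_mul, Nat.cast_ofNat] at h'
  have hc : (Fintype.card ((S ∪ T : Finset V) : Set V) : ℝ) = #S + #T := by
    rw [← Nat.cast_add, ← card_union_of_disjoint hd]
    simp
  rw [avgDeg, hc, h']

lemma degInto_erase {V : Type*} [DecidableEq V] (G : SimpleGraph V) [DecidableRel G.Adj]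
    {S : Finset V} {x : V} (hx : x ∈ S) (v : V) :
    (degInto G (S.erase x) v : ℝ) = degInto G S v - if G.Adj x v then 1 else 0 := by
  classical
  simp_rw [degInto_eq_card_filter, card_filter]
  push_cast
  rw [← add_sum_erase S _ hx]
  ring

lemma sum_comp_degInto_erase {V : Type*} [DecidableEq V] (G : SimpleGraph V)
    (S : Finset V) (v : V) (h : ℝ → ℝ) :
    ∑ x ∈ S, h (degInto G (S.erase x) v) =
      (#S - degInto G S v) * h (degInto G S v) + degInto G S v * h (degInto G S v - 1) := by
  classical
  have key : ∀ x ∈ S, h (degInto G (S.erase x) v) =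
      h (degInto G S v) +
        (if G.Adj x v then (1 : ℝ) else 0) * (h (degInto G S v - 1) - h (degInto G S v)) := by
    intro x hx
    rw [degInto_erase G hx]
    split_ifs <;> simp
  have hd : (degInto G S v : ℝ) = ∑ x ∈ S, if G.Adj x v then (1 : ℝ) else 0 := by
    rw [degInto_eq_card_filter, card_filter]
    push_cast
    rfl
  rw [sum_congr rfl key, sum_add_distrib, ← sum_mul, ← hd, sum_const, nsmul_eq_mul]
  ring

/-- Edge density of `(S, B)` per vertex of `S`, penalised by the scaled number of cherries
centred in `B`. -/
noncomputable def penalizedDensity {V : Type*} (G : SimpleGraph V) (B : Finset V) (c : ℝ)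
    (S : Finset V) : ℝ :=
  ∑ v ∈ B, ((degInto G S v : ℝ) / #S - c * (degInto G S v * (degInto G S v - 1)) / (#S : ℝ) ^ 2)

lemma natCast_mul_sub_one_nonneg (n : ℕ) : (0 : ℝ) ≤ n * (n - 1) := by
  rcases Nat.eq_zero_or_pos n with rfl | h
  · simp
  · have : (1 : ℝ) ≤ n := by exact_mod_cast h
    exact mul_nonneg (by positivity) (by linarith)

/-- Deleting a suitable vertex does not decrease the penalised density. -/
lemma exists_erase_penalizedDensity_le {V : Type*} [DecidableEq V] (G : SimpleGraph V)
    (B : Finset V) {c : ℝ} (hc : 0 ≤ c) {S : Finset V} (hS : 2 ≤ #S) :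
    ∃ x ∈ S, penalizedDensity G B c S ≤ penalizedDensity G B c (S.erase x) := by
  have hne : S.Nonempty := card_pos.mp (by omega)
  refine exists_le_of_sum_le hne ?_
  have hn : (2 : ℝ) ≤ #S := by exact_mod_cast hS
  set n : ℝ := (#S : ℝ) with hn_def
  have hcard : ∀ x ∈ S, (#(S.erase x) : ℝ) = n - 1 := by
    intro x hx
    rw [card_erase_of_mem hx, Nat.cast_sub (by omega)]
    simp [hn_def]
  have hR : ∑ x ∈ S, penalizedDensity G B c (S.erase x) = ∑ v ∈ B, ∑ x ∈ S,
      ((degInto G (S.erase x) v : ℝ) / (n - 1) -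
        c * (degInto G (S.erase x) v * (degInto G (S.erase x) v - 1)) / (n - 1) ^ 2) := by
    rw [sum_comm]
    refine sum_congr rfl fun x hx => ?_
    rw [penalizedDensity, hcard x hx]
  rw [hR, sum_const, nsmul_eq_mul, penalizedDensity, mul_sum]
  refine sum_le_sum fun v _ => ?_
  rw [sum_comp_degInto_erase G S v (fun d => d / (n - 1) - c * (d * (d - 1)) / (n - 1) ^ 2)]
  rw [← hn_def]
  have hq := natCast_mul_sub_one_nonneg (degInto G S v)
  set d : ℝ := (degInto G S v : ℝ)
  have h1 : n - 1 ≠ 0 := by linarith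
  have h0 : n ≠ 0 := by linarith
  have hpos : 0 ≤ c * (d * (d - 1)) := mul_nonneg hc hq
  have hgap : (n - d) * (d / (n - 1) - c * (d * (d - 1)) / (n - 1) ^ 2) +
      d * ((d - 1) / (n - 1) - c * ((d - 1) * (d - 1 - 1)) / (n - 1) ^ 2) -
      n * (d / n - c * (d * (d - 1)) / n ^ 2) = c * (d * (d - 1)) / (n * (n - 1) ^ 2) := by
    field_simp
    ring
  have : 0 ≤ c * (d * (d - 1)) / (n * (n - 1) ^ 2) := by positivity
  linarith

lemma exists_subset_card_eq_penalizedDensity_le {V : Type*} [DecidableEq V]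
    (G : SimpleGraph V) (A B : Finset V) {c : ℝ} (hc : 0 ≤ c) {k : ℕ} (hk : 1 ≤ k)
    (hkA : k ≤ #A) :
    ∃ S ⊆ A, #S = k ∧ penalizedDensity G B c A ≤ penalizedDensity G B c S := by
  induction hkA using Nat.decreasingInduction with
  | self => exact ⟨A, Subset.rfl, rfl, le_rfl⟩
  | of_succ m hm ih =>
    obtain ⟨S, hSA, hcard, hle⟩ := ih (by omega)
    obtain ⟨x, hx, hle'⟩ := exists_erase_penalizedDensity_le G B hc (S := S) (by omega)
    exact ⟨S.erase x, (erase_subset _ _).trans hSA, by rw [card_erase_of_mem hx]; omega,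
      hle.trans hle'⟩

/-- If `B` is the smaller side, sampling `#B` vertices from `A` and discarding the vertices of `B`
of large remaining degree keeps enough edges. -/
lemma exists_subsets_of_almostBiregular {V : Type*} [DecidableEq V] (G : SimpleGraph V)
    (A B : Finset V) {e M : ℝ} (hB : 1 ≤ #B) (hBA : #B ≤ #A) (hM : 1 ≤ M)
    (he : ∑ v ∈ B, (degInto G A v : ℝ) = e)
    (hdeg : ∀ v ∈ B, (degInto G A v : ℝ) ≤ M * #A / #B) :
    ∃ S ⊆ A, ∃ T ⊆ B, #S = #B ∧ (∀ v ∈ T, (degInto G S v : ℝ) ≤ 12 * M) ∧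
      #B * e / (2 * #A) ≤ ∑ v ∈ T, (degInto G S v : ℝ) := by
  classical
  have hb : (0 : ℝ) < #B := by exact_mod_cast hB
  have ha : (0 : ℝ) < #A := by exact_mod_cast lt_of_lt_of_le hB hBA
  have he0 : 0 ≤ e := he ▸ sum_nonneg fun v _ => by positivity
  set c : ℝ := #B / (11 * M) with hc_def
  have hc : 0 ≤ c := by positivity
  obtain ⟨S, hSA, hScard, hle⟩ := exists_subset_card_eq_penalizedDensity_le G A B hc hB hBA
  refine ⟨S, hSA, {v ∈ B | (degInto G S v : ℝ) ≤ 12 * M}, filter_subset _ _, hScard,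
    fun v hv => (mem_filter.mp hv).2, ?_⟩
  have hlow : e / #A - e / (11 * #A) ≤ penalizedDensity G B c A := by
    have : e / #A - e / (11 * #A) = ∑ v ∈ B,
        ((degInto G A v : ℝ) / #A - degInto G A v / (11 * #A)) := by
      rw [sum_sub_distrib, ← sum_div, ← sum_div, he]
    rw [this, penalizedDensity]
    refine sum_le_sum fun v hv => sub_le_sub_left ?_ _
    have h1 : (degInto G A v : ℝ) * (degInto G A v - 1) ≤
        degInto G A v * (M * #A / #B) :=
      mul_le_mul_of_nonneg_left (by linarith [hdeg v hv]) (by positivity)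
    calc c * ((degInto G A v : ℝ) * ((degInto G A v : ℝ) - 1)) / (#A : ℝ) ^ 2
        ≤ c * ((degInto G A v : ℝ) * (M * #A / #B)) / (#A : ℝ) ^ 2 := by gcongr
      _ = (degInto G A v : ℝ) / (11 * #A) := by
        rw [hc_def]
        field_simp
  have hup : penalizedDensity G B c S ≤
      (∑ v ∈ B with (degInto G S v : ℝ) ≤ 12 * M, (degInto G S v : ℝ)) / #B := by
    rw [penalizedDensity, hScard, sum_div, sum_filter]
    refine sum_le_sum fun v _ => ?_
    have hq := natCast_mul_sub_one_nonneg (degInto G S v)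
    split_ifs with h
    · have : 0 ≤ c * ((degInto G S v : ℝ) * (degInto G S v - 1)) / (#B : ℝ) ^ 2 := by
        positivity
      linarith
    · push Not at h
      have h1 : (degInto G S v : ℝ) * (11 * M) ≤ degInto G S v * (degInto G S v - 1) :=
        mul_le_mul_of_nonneg_left (by linarith) (by positivity)
      have h2 : (degInto G S v : ℝ) / #B =
          c * (degInto G S v * (11 * M)) / (#B : ℝ) ^ 2 := by
        rw [hc_def]
        field_simp
      rw [h2, sub_nonpos]
      gcongr
  have hfin := (hlow.trans hle).trans hup
  rw [le_div_iff₀ hb] at hfin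
  refine le_trans ?_ hfin
  have hx : 0 ≤ e / #A * #B := by positivity
  have h1 : #B * e / (2 * #A) = e / #A * #B * (1 / 2) := by field_simp
  have h2 : (e / #A - e / (11 * #A)) * #B = e / #A * #B * (10 / 11) := by
    field_simp
    norm_num
  rw [h1, h2]
  linarith

/-- The theorem under the normalisation that `B` is the smaller side. -/
lemma exists_induce_of_card_le {V : Type*} [Fintype V] [DecidableEq V] (G : SimpleGraph V)
    (A B : Finset V) (L : ℝ) (hdisj : Disjoint A B) (hunion : A ∪ B = univ)
    (hAA : ∀ x ∈ A, ∀ y ∈ A, ¬ G.Adj x y) (hBB : ∀ x ∈ B, ∀ y ∈ B, ¬ G.Adj x y)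
    (hA : ∀ a ∈ A, (deg G a : ℝ) ≤ L * (G.edgeSet.ncard : ℝ) / (#A : ℝ))
    (hB : ∀ b ∈ B, (deg G b : ℝ) ≤ L * (G.edgeSet.ncard : ℝ) / (#B : ℝ))
    (hBA : #B ≤ #A) (hE : 0 < G.edgeSet.ncard) :
    ∃ s : Finset V,
      avgDeg (G.induce (s : Set V)) ≥ avgDeg G / 4 ∧
      ∀ v, (deg (G.induce (s : Set V)) v : ℝ) ≤ 24 * L * avgDeg (G.induce (s : Set V)) := by
  set e : ℝ := (G.edgeSet.ncard : ℝ) with he_def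
  have he_pos : 0 < e := Nat.cast_pos.mpr hE
  have hsum : ∑ v ∈ B, degInto G A v = G.edgeSet.ncard := by
    have h := sum_degInto_union G hdisj hAA hBB
    rw [hunion] at h
    simp_rw [degInto_univ] at h
    rw [← two_mul_ncard_edgeSet] at h
    omega
  have he : ∑ v ∈ B, (degInto G A v : ℝ) = e := by
    rw [he_def, ← hsum]
    push_cast
    rfl
  have hle_deg : ∀ (S : Finset V) v, (degInto G S v : ℝ) ≤ deg G v := fun S v => by
    rw [← degInto_univ]
    exact_mod_cast degInto_mono G (subset_univ S) v
  have hB1 : 1 ≤ #B := by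
    by_contra h
    have : B = ∅ := card_eq_zero.mp (by omega)
    simp [this] at hsum
    omega
  have hb : (0 : ℝ) < #B := by exact_mod_cast hB1
  have ha : (0 : ℝ) < #A := by exact_mod_cast lt_of_lt_of_le hB1 hBA
  have hba : (#B : ℝ) ≤ #A := by exact_mod_cast hBA
  have hM : 1 ≤ L * e / #A := by
    have hpos : 0 < ∑ v ∈ A, degInto G B v := by rw [sum_degInto_comm, hsum]; exact hE
    obtain ⟨v, hv, hv0⟩ := sum_pos_iff.mp hpos
    have h1 : (1 : ℝ) ≤ degInto G B v := by exact_mod_cast hv0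
    exact h1.trans ((hle_deg B v).trans (hA v hv))
  have hL : 0 < L := by
    by_contra h
    push Not at h
    have : L * e / #A ≤ 0 :=
      div_nonpos_of_nonpos_of_nonneg (mul_nonpos_of_nonpos_of_nonneg h he_pos.le) ha.le
    linarith
  obtain ⟨S, hSA, T, hTB, hS, hTdeg, hTsum⟩ :=
    exists_subsets_of_almostBiregular G A B hB1 hBA hM he fun v hv => by
      refine ((hle_deg A v).trans (hB v hv)).trans (le_of_eq ?_)
      field_simp
  have hSS : ∀ x ∈ S, ∀ y ∈ S, ¬ G.Adj x y := fun x hx y hy => hAA x (hSA hx) y (hSA hy)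
  have hTT : ∀ x ∈ T, ∀ y ∈ T, ¬ G.Adj x y := fun x hx y hy => hBB x (hTB hx) y (hTB hy)
  have hST : Disjoint S T := disjoint_of_subset_left hSA (disjoint_of_subset_right hTB hdisj)
  have havg : e / (2 * #A) ≤ avgDeg (G.induce ((S ∪ T : Finset V) : Set V)) := by
    rw [avgDeg_induce_union G hST hSS hTT, hS]
    have hT : (#T : ℝ) ≤ #B := by exact_mod_cast card_le_card hTB
    rw [le_div_iff₀ (by positivity)]
    push_cast
    calc e / (2 * #A) * (#B + #T) ≤ e / (2 * #A) * (#B + #B) := by gcongr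
      _ = 2 * (#B * e / (2 * #A)) := by ring
      _ ≤ _ := by gcongr
  have h12 : 12 * (L * e / #A) ≤
      24 * L * avgDeg (G.induce ((S ∪ T : Finset V) : Set V)) := by
    calc 12 * (L * e / #A) = 24 * L * (e / (2 * #A)) := by field_simp; norm_num
      _ ≤ _ := by gcongr
  refine ⟨S ∪ T, ?_, ?_⟩
  · refine le_trans ?_ havg
    have hc : (Fintype.card V : ℝ) = #A + #B := by
      rw [← card_univ, ← hunion, card_union_of_disjoint hdisj]
      push_cast
      rfl
    rw [avgDeg, hc, ← he_def]
    calc 2 * e / (#A + #B) / 4 ≤ 2 * e / #A / 4 := by gcongr; linarith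
      _ = e / (2 * #A) := by field_simp; norm_num
  · intro v
    refine le_trans ?_ h12
    rw [deg_induce]
    rcases mem_union.mp (mem_coe.mp v.2) with hv | hv
    · have := (hle_deg (S ∪ T) v).trans (hA v (hSA hv))
      linarith
    · rw [degInto_union_of_forall_not_adj G S T v fun x hx => hTT x hx v hv]
      exact hTdeg v hv

/-- Every `L`-almost-biregular bipartite graph `Γ` has an induced
subgraph `Γ'` with `d(Γ') ≥ d(Γ)/4` and `Δ(Γ') ≤ 24 L d(Γ')`. -/
theorem stmt6 :
    ∀ (V : Type) [Fintype V] [DecidableEq V] (G : SimpleGraph V) (A B : Finset V) (L : ℝ),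
      Disjoint A B → A ∪ B = Finset.univ →
      (∀ u v : V, G.Adj u v → (u ∈ A ∧ v ∈ B) ∨ (u ∈ B ∧ v ∈ A)) →
      (∀ a ∈ A, (deg G a : ℝ) ≤ L * (G.edgeSet.ncard : ℝ) / (A.card : ℝ)) →
      (∀ b ∈ B, (deg G b : ℝ) ≤ L * (G.edgeSet.ncard : ℝ) / (B.card : ℝ)) →
      ∃ s : Finset V,
        avgDeg (G.induce (s : Set V)) ≥ avgDeg G / 4 ∧
        ∀ v, (deg (G.induce (s : Set V)) v : ℝ) ≤ 24 * L * avgDeg (G.induce (s : Set V)) := by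
  intro V _ _ G A B L hdisj hunion hadj hA hB
  have hAA : ∀ x ∈ A, ∀ y ∈ A, ¬ G.Adj x y := fun x hx y hy h =>
    (hadj x y h).elim (fun h => disjoint_left.mp hdisj hy h.2)
      fun h => disjoint_left.mp hdisj hx h.1
  have hBB : ∀ x ∈ B, ∀ y ∈ B, ¬ G.Adj x y := fun x hx y hy h =>
    (hadj x y h).elim (fun h => disjoint_left.mp hdisj h.1 hx)
      fun h => disjoint_left.mp hdisj h.2 hy
  rcases Nat.eq_zero_or_pos G.edgeSet.ncard with hE | hE
  · refine ⟨∅, ?_, fun v => absurd v.2 (by simp)⟩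
    have : avgDeg G / 4 = 0 := by simp [avgDeg, hE]
    rw [this, avgDeg]
    positivity
  rcases le_total #B #A with hle | hle
  · exact exists_induce_of_card_le G A B L hdisj hunion hAA hBB hA hB hle hE
  · exact exists_induce_of_card_le G B A L hdisj.symm (by rw [union_comm, hunion])
      hBB hAA hB hA hle hE
end

section
/- Fix ε ∈ (0, 1/10) and assume d is sufficiently large with respect to ε. Let G be an n-vertex graph with average degree d(G) ≥ d and maximum degree Δ(G) ≤ d^{1+ε}. Then G contains either an induced subgraph G' on n' vertices with n' ≥ d^{1 − (3/2)ε} and average degree d(G') ≥ (n')^{1 − 5ε}, or an induced subgraph G'' which contains no cycle of length 4 and has average degree d(G'') ≥ d^{ε/20}. -/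
open Finset

open Classical in
theorem avgDeg_mul_card {V : Type*} [Fintype V] (G : SimpleGraph V) :
    avgDeg G * Fintype.card V = ∑ u : V, ∑ v : V, if G.Adj u v then (1 : ℝ) else 0 := by
  have h := G.sum_degrees_eq_twice_card_edges
  have h2 : G.edgeSet.ncard = #G.edgeFinset := by
    rw [← SimpleGraph.coe_edgeFinset, Set.ncard_coe_finset]
  have h3 : ∑ u : V, ∑ v : V, (if G.Adj u v then (1 : ℝ) else 0) = 2 * G.edgeSet.ncard := by
    rw [h2, ← Nat.cast_ofNat, ← Nat.cast_mul, ← h, Nat.cast_sum]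
    refine sum_congr rfl fun u _ => ?_
    rw [← SimpleGraph.card_neighborFinset_eq_degree, SimpleGraph.neighborFinset_eq_filter,
      sum_boole]
  rw [h3]
  unfold avgDeg
  rcases isEmpty_or_nonempty V with hV | hV
  · have h0 : ∑ v, G.degree v = 0 := by simp
    have h1 : G.edgeSet.ncard = 0 := by omega
    simp [h1]
  · field_simp

open Classical in
theorem avgDeg_induce_mul_card {V : Type*} [Fintype V] (G : SimpleGraph V) (s : Finset V) :
    avgDeg (G.induce (s : Set V)) * #s =
      ∑ u ∈ s, ∑ v ∈ s, if G.Adj u v then (1 : ℝ) else 0 := by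
  have h := avgDeg_mul_card (G.induce (s : Set V))
  have hc : Fintype.card (s : Set V) = #s := by simp
  rw [hc] at h
  rw [h, ← sum_coe_sort s]
  refine sum_congr rfl fun u _ => ?_
  rw [← sum_coe_sort s]
  rfl

/-- The probability that a random vertex set, containing each vertex independently with
probability `q`, is equal to `S`. -/
noncomputable def sampleWeight {V : Type*} [Fintype V] (q : ℝ) (S : Finset V) : ℝ :=
  q ^ #S * (1 - q) ^ (Fintype.card V - #S)

open Classical in
theorem sum_sampleWeight_superset {V : Type*} [Fintype V] (q : ℝ) (T : Finset V) :
    ∑ S : Finset V, sampleWeight q S * (if T ⊆ S then 1 else 0) = q ^ #T := by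
  have h := prod_add (fun _ : V => q) (fun v => if v ∈ T then 0 else 1 - q) univ
  have h1 : ∏ v : V, (q + if v ∈ T then 0 else 1 - q) = q ^ #T := by
    rw [← prod_const, ← prod_subset (subset_univ T)]
    · exact prod_congr rfl fun v hv => by simp [hv]
    · intro v _ hv
      simp [hv]
  rw [← h1, h, powerset_univ]
  refine sum_congr rfl fun S _ => ?_
  rw [prod_const, sampleWeight, mul_assoc]
  congr 1
  split_ifs with hTS
  · rw [prod_congr rfl (g := fun _ => 1 - q), prod_const, card_sdiff_of_subset (subset_univ S),
      card_univ, mul_one]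
    intro v hv
    rw [if_neg fun hT => (mem_sdiff.1 hv).2 (hTS hT)]
  · obtain ⟨v, hvT, hvS⟩ := not_subset.1 hTS
    rw [mul_zero, prod_eq_zero (i := v) (by simp [hvS]) (by simp [hvT])]

open Classical in
theorem sum_pow_card_insert_le {V : Type*} {q D : ℝ} (hq : 0 ≤ q) {N T : Finset V}
    (hN : (#N : ℝ) ≤ D) :
    ∑ v ∈ N, q ^ #(insert v T) ≤ D * q ^ (#T + 1) + #T * q ^ #T := by
  have h : ∀ v ∈ N, q ^ #(insert v T) ≤ q ^ (#T + 1) + if v ∈ T then q ^ #T else 0 := by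
    intro v _
    by_cases hv : v ∈ T
    · rw [insert_eq_of_mem hv, if_pos hv]
      exact le_add_of_nonneg_left (by positivity)
    · rw [card_insert_of_notMem hv, if_neg hv, add_zero]
  refine (sum_le_sum h).trans ?_
  rw [sum_add_distrib, sum_const, nsmul_eq_mul, ← sum_filter, sum_const, nsmul_eq_mul]
  have : #(N.filter (· ∈ T)) ≤ #T := card_le_card fun v hv => (mem_filter.1 hv).2
  gcongr

/-- A bounded-size subset of `N` carrying at least its fair share of `∑ f`. -/
theorem exists_subset_card_le_sum {V : Type*} (f : V → ℝ) (hf : ∀ v, 0 ≤ f v) (m : ℕ) {D : ℝ}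
    (hm : (m : ℝ) ≤ D) (N : Finset V) (hN : (#N : ℝ) ≤ D) :
    ∃ A ⊆ N, #A ≤ m ∧ m * ∑ v ∈ N, f v ≤ D * ∑ v ∈ A, f v := by
  classical
  by_cases hmN : #N ≤ m
  · exact ⟨N, Subset.rfl, hmN, mul_le_mul_of_nonneg_right hm (sum_nonneg fun v _ => hf v)⟩
  push Not at hmN
  have key : ∀ j, m ≤ j → j ≤ #N →
      ∃ A ⊆ N, #A = j ∧ j * ∑ v ∈ N, f v ≤ #N * ∑ v ∈ A, f v := by
    intro j hmj hj
    induction hj using Nat.decreasingInduction with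
    | self => exact ⟨N, Subset.rfl, rfl, le_rfl⟩
    | of_succ j hj ih =>
      obtain ⟨A, hAN, hA, hs⟩ := ih (by omega)
      obtain ⟨x, hx, hmin⟩ := exists_min_image A f (card_pos.1 (by omega))
      refine ⟨A.erase x, (erase_subset _ _).trans hAN, by rw [card_erase_of_mem hx]; omega, ?_⟩
      have h1 : (#A : ℝ) * f x ≤ ∑ v ∈ A, f v := by
        simpa using card_nsmul_le_sum A f (f x) hmin
      have h2 := add_sum_erase A f hx
      rw [hA] at h1
      push_cast at h1 hs
      have h3 : (0 : ℝ) < j + 1 := by positivity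
      have h4 : (0 : ℝ) ≤ #N := by positivity
      have h5 : (j : ℝ) * ∑ v ∈ A, f v ≤ (j + 1) * ∑ v ∈ A.erase x, f v := by
        rw [← h2] at h1 ⊢
        linarith
      refine le_of_mul_le_mul_left ?_ h3
      have := mul_le_mul_of_nonneg_left hs (Nat.cast_nonneg (α := ℝ) j)
      have := mul_le_mul_of_nonneg_left h5 h4
      linarith
  obtain ⟨A, hAN, hA, hs⟩ := key m le_rfl hmN.le
  exact ⟨A, hAN, hA.le, hs.trans (mul_le_mul_of_nonneg_right hN (sum_nonneg fun v _ => hf v))⟩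

/-- The vertices `w ≠ u` having at least `t` common neighbours with `u`. -/
noncomputable def heavy {V : Type*} [Fintype V] (G : SimpleGraph V) (t : ℝ) (u : V) :
    Finset V :=
  open Classical in
  {w | w ≠ u ∧ t ≤ #(G.neighborFinset u ∩ G.neighborFinset w)}

/-- Many vertices of large codegree with `u` give a dense induced subgraph. -/
theorem exists_dense_of_heavy {V : Type*} [Fintype V] (G : SimpleGraph V) {t D : ℝ}
    (hD : 0 < D) {u : V} (hu : (deg G u : ℝ) ≤ D) {m : ℕ} (hm0 : 0 < m) (hmD : (m : ℝ) ≤ D)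
    (hm : m ≤ #(heavy G t u)) :
    ∃ s : Finset V, m ≤ #s ∧ #s ≤ 2 * m ∧
      m * t / (2 * D) ≤ avgDeg (G.induce (s : Set V)) := by
  classical
  obtain ⟨W, hW, hWm⟩ := exists_subset_card_eq hm
  have hN : (#(G.neighborFinset u) : ℝ) ≤ D := by
    rwa [deg, ← SimpleGraph.coe_neighborFinset, Set.ncard_coe_finset] at hu
  obtain ⟨A, hAN, hA, hs⟩ := exists_subset_card_le_sum
    (fun x => ∑ w ∈ W, if G.Adj x w then (1 : ℝ) else 0)
    (fun x => sum_nonneg fun w _ => by split_ifs <;> norm_num) m hmD (G.neighborFinset u) hN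
  have hsum : m * t ≤ ∑ x ∈ G.neighborFinset u, ∑ w ∈ W, if G.Adj x w then (1 : ℝ) else 0 := by
    rw [sum_comm, ← hWm, ← nsmul_eq_mul]
    refine card_nsmul_le_sum _ _ _ fun w hw => ?_
    have h := hW hw
    simp only [heavy, mem_filter, mem_univ, true_and] at h
    refine h.2.trans (le_of_eq ?_)
    rw [sum_boole]
    congr 2
    ext x
    simp [G.adj_comm]
  have hle : ∑ x ∈ A, ∑ w ∈ W, (if G.Adj x w then (1 : ℝ) else 0) ≤
      ∑ x ∈ A ∪ W, ∑ w ∈ A ∪ W, if G.Adj x w then (1 : ℝ) else 0 := by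
    have h0 : ∀ x w, (0 : ℝ) ≤ if G.Adj x w then (1 : ℝ) else 0 := fun x w => by
      split_ifs <;> norm_num
    refine (sum_le_sum fun x _ => sum_le_sum_of_subset_of_nonneg subset_union_right
      fun w _ _ => h0 x w).trans (sum_le_sum_of_subset_of_nonneg subset_union_left
      fun x _ _ => sum_nonneg fun w _ => h0 x w)
  rw [← avgDeg_induce_mul_card] at hle
  have hc1 : m ≤ #(A ∪ W) := hWm ▸ card_le_card subset_union_right
  have hc2 : #(A ∪ W) ≤ 2 * m := (card_union_le A W).trans (by omega)
  refine ⟨A ∪ W, hc1, hc2, ?_⟩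
  have hpos : 0 ≤ avgDeg (G.induce ((A ∪ W : Finset V) : Set V)) := by
    unfold avgDeg; positivity
  have hc3 : (#(A ∪ W) : ℝ) ≤ 2 * m := by exact_mod_cast hc2
  have hm' : (0 : ℝ) < m := by exact_mod_cast hm0
  rw [div_le_iff₀ (by positivity)]
  refine le_of_mul_le_mul_left ?_ hm'
  calc (m : ℝ) * (m * t) ≤ _ := mul_le_mul_of_nonneg_left hsum hm'.le
    _ ≤ _ := hs
    _ ≤ D * (avgDeg (G.induce ((A ∪ W : Finset V) : Set V)) * #(A ∪ W)) :=
      mul_le_mul_of_nonneg_left hle hD.le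
    _ ≤ D * (avgDeg (G.induce ((A ∪ W : Finset V) : Set V)) * (2 * m)) := by gcongr
    _ = _ := by ring

/-- Sample a vertex set and delete each sampled `u` for which a configuration of `Q u` is
entirely sampled; if the configurations are rare then some outcome has large average degree. -/
theorem exists_avgDeg_avoiding {V : Type*} [Fintype V] (G : SimpleGraph V)
    (Q : V → Finset (Finset V)) {q D K d y : ℝ} (hq0 : 0 < q) (hq1 : q ≤ 1) (hd : 0 < d)
    (hy : 0 ≤ y) (hdeg : ∀ v, (deg G v : ℝ) ≤ D) (havg : d ≤ avgDeg G)
    (hQ : ∀ u, ∑ T ∈ Q u, (D * q ^ (#T + 1) + #T * q ^ #T) ≤ K)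
    (hK : y * q + 2 * K < d * q ^ 2) :
    ∃ S : Finset V, (∀ u ∈ S, ∀ T ∈ Q u, ¬ T ⊆ S) ∧ y ≤ avgDeg (G.induce (S : Set V)) := by
  classical
  have hN : ∀ u, (#(G.neighborFinset u) : ℝ) ≤ D := fun u => by
    have := hdeg u
    rwa [deg, ← SimpleGraph.coe_neighborFinset, Set.ncard_coe_finset] at this
  have hV : Nonempty V := by
    by_contra hV
    rw [not_nonempty_iff] at hV
    simp only [avgDeg, Fintype.card_eq_zero, CharP.cast_eq_zero, div_zero] at havg
    linarith
  have hn : (0 : ℝ) < Fintype.card V := by exact_mod_cast Fintype.card_pos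
  let X : Finset V → ℝ := fun S =>
    ∑ u : V, ∑ v ∈ G.neighborFinset u, if ({u, v} : Finset V) ⊆ S then 1 else 0
  let Y : Finset V → ℝ := fun S =>
    ∑ u : V, ∑ T ∈ Q u, ∑ v ∈ G.neighborFinset u, if insert v T ⊆ S then 1 else 0
  let Z : Finset V → ℝ := fun S => ∑ u : V, if ({u} : Finset V) ⊆ S then 1 else 0
  have hX : d * Fintype.card V * q ^ 2 ≤ ∑ S, sampleWeight q S * X S := by
    have h1 : ∑ S, sampleWeight q S * X S =
        ∑ u : V, ∑ v ∈ G.neighborFinset u, q ^ #({u, v} : Finset V) := by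
      simp only [X, mul_sum]
      rw [sum_comm]
      refine sum_congr rfl fun u _ => ?_
      rw [sum_comm]
      exact sum_congr rfl fun v _ => sum_sampleWeight_superset q _
    have h2 : ∑ u : V, ∑ v ∈ G.neighborFinset u, q ^ #({u, v} : Finset V) =
        avgDeg G * Fintype.card V * q ^ 2 := by
      rw [avgDeg_mul_card, sum_mul]
      refine sum_congr rfl fun u _ => ?_
      rw [SimpleGraph.neighborFinset_eq_filter, sum_filter, sum_mul]
      refine sum_congr rfl fun v _ => ?_
      split_ifs with h
      · rw [card_pair h.ne, one_mul]
      · rw [zero_mul]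
    rw [h1, h2]
    gcongr
  have hY : ∑ S, sampleWeight q S * Y S ≤ Fintype.card V * K := by
    have h1 : ∑ S, sampleWeight q S * Y S =
        ∑ u : V, ∑ T ∈ Q u, ∑ v ∈ G.neighborFinset u, q ^ #(insert v T) := by
      simp only [Y, mul_sum]
      rw [sum_comm]
      refine sum_congr rfl fun u _ => ?_
      rw [sum_comm]
      refine sum_congr rfl fun T _ => ?_
      rw [sum_comm]
      exact sum_congr rfl fun v _ => sum_sampleWeight_superset q _
    rw [h1, ← nsmul_eq_mul, ← card_univ]
    exact sum_le_card_nsmul _ _ _ fun u _ =>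
      (sum_le_sum fun T _ => sum_pow_card_insert_le hq0.le (hN u)).trans (hQ u)
  have hZ : ∑ S, sampleWeight q S * Z S = Fintype.card V * q := by
    simp only [Z, mul_sum]
    rw [sum_comm]
    simp only [sum_sampleWeight_superset, card_singleton, pow_one, sum_const, card_univ,
      nsmul_eq_mul]
  obtain ⟨S, hS⟩ : ∃ S, 0 < X S - 2 * Y S - y * Z S := by
    by_contra! hneg
    have h1 : ∑ S, sampleWeight q S * (X S - 2 * Y S - y * Z S) ≤ 0 := by
      refine sum_nonpos fun S _ => mul_nonpos_of_nonneg_of_nonpos ?_ (hneg S)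
      have : 0 ≤ 1 - q := by linarith
      unfold sampleWeight
      positivity
    have h2 : ∑ S, sampleWeight q S * (X S - 2 * Y S - y * Z S) =
        ∑ S, sampleWeight q S * X S - 2 * ∑ S, sampleWeight q S * Y S -
          y * ∑ S, sampleWeight q S * Z S := by
      rw [mul_sum, mul_sum, ← sum_sub_distrib, ← sum_sub_distrib]
      exact sum_congr rfl fun S _ => by ring
    have h3 := mul_lt_mul_of_pos_left hK hn
    rw [h2, hZ] at h1
    linarith
  set R : Finset V := {u ∈ S | ∀ T ∈ Q u, ¬ T ⊆ S} with hR
  have hRS : R ⊆ S := filter_subset _ _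
  let f : V → V → ℝ := fun u v => if G.Adj u v ∧ u ∈ S ∧ v ∈ S ∧ u ∉ R then 1 else 0
  have hf : ∑ u : V, ∑ v : V, f u v ≤ Y S := by
    refine sum_le_sum fun u _ => ?_
    rw [sum_comm, SimpleGraph.neighborFinset_eq_filter, sum_filter]
    refine sum_le_sum fun v _ => ?_
    have h0 : ∀ T, (0 : ℝ) ≤ if insert v T ⊆ S then 1 else 0 := fun T => by
      split_ifs <;> norm_num
    by_cases h : G.Adj u v ∧ u ∈ S ∧ v ∈ S ∧ u ∉ R
    · obtain ⟨hadj, huS, hvS, huR⟩ := h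
      simp only [hR, mem_filter, huS, true_and, not_forall, not_not] at huR
      obtain ⟨T, hT, hTS⟩ := huR
      rw [if_pos hadj]
      refine le_trans ?_ (single_le_sum (fun T _ => h0 T) hT)
      rw [if_pos (insert_subset hvS hTS)]
      simp only [f]
      split_ifs <;> norm_num
    · simp only [f, if_neg h]
      split_ifs
      · exact sum_nonneg fun T _ => h0 T
      · exact le_rfl
  have hXR : X S ≤ (∑ u ∈ R, ∑ v ∈ R, if G.Adj u v then (1 : ℝ) else 0) + 2 * Y S := by
    have h1 : X S ≤ ∑ u : V, ∑ v : V,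
        ((if u ∈ R then (if v ∈ R then (if G.Adj u v then (1 : ℝ) else 0) else 0) else 0) +
          f u v + f v u) := by
      refine sum_le_sum fun u _ => ?_
      rw [SimpleGraph.neighborFinset_eq_filter, sum_filter]
      refine sum_le_sum fun v _ => ?_
      simp only [f, G.adj_comm v u, insert_subset_iff, singleton_subset_iff]
      by_cases h1 : G.Adj u v <;> by_cases h2 : u ∈ S <;> by_cases h3 : v ∈ S <;>
        by_cases h4 : u ∈ R <;> by_cases h5 : v ∈ R <;> simp [h1, h2, h3, h4, h5]
    have h2 : ∑ u : V, ∑ v : V, f v u = ∑ u : V, ∑ v : V, f u v := sum_comm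
    have h3 : ∑ u : V, ∑ v : V,
        (if u ∈ R then (if v ∈ R then (if G.Adj u v then (1 : ℝ) else 0) else 0) else 0) =
        ∑ u ∈ R, ∑ v ∈ R, if G.Adj u v then (1 : ℝ) else 0 := by
      rw [← univ_inter R, ← sum_ite_mem, univ_inter]
      refine sum_congr rfl fun u _ => ?_
      split_ifs
      · rw [sum_ite_mem, univ_inter]
      · exact sum_const_zero
    simp only [sum_add_distrib] at h1
    rw [h2, h3] at h1
    linarith
  have hZR : (#R : ℝ) ≤ Z S := by
    have : Z S = #S := by simp [Z]
    rw [this]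
    exact_mod_cast card_le_card hRS
  rw [← avgDeg_induce_mul_card] at hXR
  have hfin : y * #R < avgDeg (G.induce (R : Set V)) * #R := by
    have := mul_le_mul_of_nonneg_left hZR hy
    linarith
  refine ⟨R, fun u hu T hT hTR => (mem_filter.1 hu).2 T hT (hTR.trans hRS), ?_⟩
  exact (lt_of_mul_lt_mul_right hfin (Nat.cast_nonneg _)).le

/-- Sampling with deletion produces a `C₄`-free induced subgraph when every vertex has few
partners of large codegree. -/
theorem exists_c4Free {V : Type*} [Fintype V] (G : SimpleGraph V) {q D d y m t : ℝ}
    (hq0 : 0 < q) (hq1 : q ≤ 1) (hd : 0 < d) (hy : 0 ≤ y) (hD : 0 ≤ D) (ht : 0 ≤ t)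
    (hdeg : ∀ v, (deg G v : ℝ) ≤ D) (havg : d ≤ avgDeg G)
    (hheavy : ∀ u, (#(heavy G t u) : ℝ) ≤ m)
    (hK : y * q + 2 * (m * (D * q ^ 3 + 2 * q ^ 2) + D * D * t * (D * q ^ 5 + 4 * q ^ 4)) <
      d * q ^ 2) :
    ∃ S : Finset V, C4Free (G.induce (S : Set V)) ∧ y ≤ avgDeg (G.induce (S : Set V)) := by
  classical
  have hN : ∀ u, (#(G.neighborFinset u) : ℝ) ≤ D := fun u => by
    have := hdeg u
    rwa [deg, ← SimpleGraph.coe_neighborFinset, Set.ncard_coe_finset] at this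
  let P : V → Finset (Finset V) := fun u => (heavy G t u).image fun w => {u, w}
  let B : V → V → Finset V := fun u a => {b ∈ G.neighborFinset a | b ≠ u ∧ b ∉ heavy G t u}
  let E : V → V → V → Finset V := fun u a b =>
    (G.neighborFinset u ∩ G.neighborFinset b).erase a
  let C : V → Finset (Finset V) := fun u => (G.neighborFinset u).biUnion fun a =>
    (B u a).biUnion fun b => (E u a b).image fun c => {u, a, b, c}
  have hP : ∀ u, (#(P u) : ℝ) ≤ m := fun u =>
    le_trans (by exact_mod_cast card_image_le) (hheavy u)
  have hE : ∀ u a, ∀ b ∈ B u a, (#(E u a b) : ℝ) ≤ t := by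
    intro u a b hb
    simp only [B, heavy, mem_filter, mem_univ, true_and, not_and, not_le] at hb
    refine le_trans ?_ (hb.2.2 hb.2.1).le
    exact_mod_cast card_le_card (erase_subset _ _)
  have hC : ∀ u, (#(C u) : ℝ) ≤ D * D * t := by
    intro u
    have h1 : ∀ a, (#((B u a).biUnion fun b =>
        (E u a b).image fun c => ({u, a, b, c} : Finset V)) : ℝ) ≤ D * t := by
      intro a
      calc _ ≤ ((∑ b ∈ B u a, #(E u a b) : ℕ) : ℝ) := by
            exact_mod_cast card_biUnion_le.trans (sum_le_sum fun b _ => card_image_le)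
        _ ≤ #(B u a) * t := by
            rw [Nat.cast_sum, ← nsmul_eq_mul]
            exact sum_le_card_nsmul _ _ _ (hE u a)
        _ ≤ D * t := by
            gcongr
            exact le_trans (by exact_mod_cast card_le_card (filter_subset _ _)) (hN a)
    calc _ ≤ ((∑ a ∈ G.neighborFinset u, #((B u a).biUnion fun b =>
          (E u a b).image fun c => ({u, a, b, c} : Finset V)) : ℕ) : ℝ) := by
          exact_mod_cast card_biUnion_le
      _ ≤ #(G.neighborFinset u) * (D * t) := by
          rw [Nat.cast_sum, ← nsmul_eq_mul]
          exact sum_le_card_nsmul _ _ _ fun a _ => h1 a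
      _ ≤ D * (D * t) := by
          gcongr
          exact hN u
      _ = D * D * t := by ring
  have hPcard : ∀ u, ∀ T ∈ P u, #T = 2 := by
    intro u T hT
    obtain ⟨w, hw, rfl⟩ := mem_image.1 hT
    simp only [heavy, mem_filter, mem_univ, true_and] at hw
    exact card_pair hw.1.symm
  have hCcard : ∀ u, ∀ T ∈ C u, #T = 4 := by
    intro u T hT
    simp only [C, B, E, mem_biUnion, mem_image, mem_filter, mem_erase, mem_inter,
      SimpleGraph.mem_neighborFinset] at hT
    obtain ⟨a, hua, b, ⟨hab, hbu, -⟩, c, ⟨hca, huc, hbc⟩, rfl⟩ := hT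
    have := hua.ne; have := hab.ne; have := huc.ne; have := hbc.ne
    rw [card_insert_of_notMem, card_insert_of_notMem, card_pair] <;> simp_all [eq_comm]
  obtain ⟨S, hS, hav⟩ := exists_avgDeg_avoiding G (fun u => P u ∪ C u) hq0 hq1 hd hy hdeg havg
    (K := m * (D * q ^ 3 + 2 * q ^ 2) + D * D * t * (D * q ^ 5 + 4 * q ^ 4)) (by
      intro u
      have h0 : ∀ T : Finset V, 0 ≤ D * q ^ (#T + 1) + #T * q ^ #T := fun T => by positivity
      have h1 : ∑ T ∈ P u ∪ C u, (D * q ^ (#T + 1) + #T * q ^ #T) ≤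
          ∑ T ∈ P u, (D * q ^ (#T + 1) + #T * q ^ #T) +
            ∑ T ∈ C u, (D * q ^ (#T + 1) + #T * q ^ #T) := by
        rw [← sum_union_inter]
        exact le_add_of_nonneg_right (sum_nonneg fun T _ => h0 T)
      refine h1.trans (add_le_add ?_ ?_)
      · rw [sum_congr rfl fun T hT => by rw [hPcard u T hT], sum_const, nsmul_eq_mul]
        push_cast
        exact mul_le_mul_of_nonneg_right (hP u) (by positivity)
      · rw [sum_congr rfl fun T hT => by rw [hCcard u T hT], sum_const, nsmul_eq_mul]
        push_cast
        exact mul_le_mul_of_nonneg_right (hC u) (by positivity)) hK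
  refine ⟨S, ?_, hav⟩
  rintro ⟨⟨a, ha⟩, ⟨b, hb⟩, ⟨c, hc⟩, ⟨e, he⟩, -, hac, -, -, hbe, -, hab, hbc, hce, hea⟩
  simp only [SimpleGraph.comap_adj, Function.Embedding.subtype_apply, ne_eq, Subtype.mk.injEq] at *
  rw [mem_coe] at ha hb hc he
  have hlight : c ∉ heavy G t a := fun h =>
    hS a ha _ (mem_union_left _ (mem_image_of_mem _ h)) (by simp [insert_subset_iff, ha, hc])
  refine hS a ha {a, b, c, e} (mem_union_right _ ?_) (by simp [insert_subset_iff, ha, hb, hc, he])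
  simp only [C, B, E, mem_biUnion, mem_image, mem_filter, mem_erase, mem_inter,
    SimpleGraph.mem_neighborFinset]
  exact ⟨b, hab, c, ⟨hbc, Ne.symm hac, hlight⟩, e, ⟨Ne.symm hbe, hea.symm, hce⟩, rfl⟩

/-- Either a polynomially dense induced subgraph, or a `C₄`-free
induced subgraph of polynomial average degree. -/
theorem stmt10 :
    ∀ ε : ℝ, 0 < ε → ε < 1 / 10 →
      ∃ d₀ : ℝ, ∀ d : ℝ, d₀ ≤ d →
        ∀ (V : Type) [Fintype V] (G : SimpleGraph V),
          avgDeg G ≥ d →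
          (∀ v : V, (deg G v : ℝ) ≤ d ^ ((1 : ℝ) + ε)) →
          (∃ s : Finset V, (s.card : ℝ) ≥ d ^ ((1 : ℝ) - 3 / 2 * ε) ∧
              avgDeg (G.induce (s : Set V)) ≥ (s.card : ℝ) ^ ((1 : ℝ) - 5 * ε)) ∨
          (∃ s : Finset V, C4Free (G.induce (s : Set V)) ∧
              avgDeg (G.induce (s : Set V)) ≥ d ^ (ε / 20)) := by
  intro ε hε0 hε1
  refine ⟨21 ^ (20 / ε), fun d hd V _ G havg hdeg => ?_⟩
  have hd1 : 1 ≤ d := le_trans (Real.one_le_rpow (by norm_num) (by positivity)) hd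
  have hd0 : 0 < d := by linarith
  obtain ⟨e, he⟩ : ∃ e, e = d ^ (ε / 20) := ⟨_, rfl⟩
  have hpow : ∀ (k : ℕ), e ^ k = d ^ (ε / 20 * k) := fun k => by
    rw [he, ← Real.rpow_natCast, ← Real.rpow_mul hd0.le]
  have he21 : 21 ≤ e := by
    have h := Real.rpow_le_rpow (by positivity) hd (by positivity : 0 ≤ ε / 20)
    rw [← Real.rpow_mul (by norm_num)] at h
    rw [he]
    refine le_trans (le_of_eq ?_) h
    rw [div_mul_div_cancel₀' (by norm_num), div_self hε0.ne', Real.rpow_one]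
  have he0 : 0 < e := by linarith
  have hed : e ^ 2 ≤ d := by
    rw [hpow]
    exact (Real.rpow_le_rpow_of_exponent_le hd1 (by push_cast; linarith)).trans_eq
      (Real.rpow_one d)
  have hD : d ^ (1 + ε) = d * e ^ 20 := by
    rw [hpow, Real.rpow_add hd0, Real.rpow_one]
    congr 2
    push_cast
    ring
  have hm : d ^ (1 - 3 / 2 * ε) = d / e ^ 30 := by
    rw [hpow, Real.rpow_sub hd0, Real.rpow_one]
    congr 2
    push_cast
    ring
  have hp : ∀ k : ℕ, 1 ≤ e ^ k := fun k => one_le_pow₀ (by linarith)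
  rw [hD] at hdeg
  rw [← he]
  obtain ⟨m, hmdef⟩ : ∃ m, m = ⌈d / e ^ 30⌉₊ := ⟨_, rfl⟩
  have hm0 : 0 < m := hmdef ▸ Nat.ceil_pos.2 (by positivity)
  have hmle : d / e ^ 30 ≤ m := hmdef ▸ Nat.le_ceil _
  have hmD : (m : ℝ) ≤ d * e ^ 20 := by
    have h1 : (m : ℝ) < d / e ^ 30 + 1 := hmdef ▸ Nat.ceil_lt_add_one (by positivity)
    have h2 : d / e ^ 30 ≤ d := div_le_self hd0.le (hp 30)
    have h3 : e ≤ e ^ 20 := le_self_pow₀ (by linarith) (by norm_num)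
    nlinarith
  by_cases hheavy : ∃ u, m ≤ #(heavy G (4 * d / e ^ 65) u)
  · left
    obtain ⟨u, hu⟩ := hheavy
    obtain ⟨s, hs1, hs2, hs⟩ := exists_dense_of_heavy G (by positivity) (hdeg u) hm0 hmD hu
    have hs1' : (m : ℝ) ≤ #s := by exact_mod_cast hs1
    have hs2' : (#s : ℝ) ≤ 2 * m := by exact_mod_cast hs2
    have hm' : (0 : ℝ) < m := by exact_mod_cast hm0
    refine ⟨s, by rw [hm]; exact hmle.trans hs1', le_trans ?_ hs⟩
    calc (#s : ℝ) ^ (1 - 5 * ε) ≤ (2 * m) ^ (1 - 5 * ε) :=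
          Real.rpow_le_rpow (by positivity) hs2' (by linarith)
      _ = 2 * m * (2 * m) ^ (-(5 * ε)) := by
          rw [sub_eq_add_neg, Real.rpow_add (by positivity), Real.rpow_one]
      _ ≤ 2 * m * (d ^ (1 - 3 / 2 * ε)) ^ (-(5 * ε)) := by
          gcongr 2 * m * ?_
          exact Real.rpow_le_rpow_of_nonpos (by positivity) (by rw [hm]; linarith) (by linarith)
      _ ≤ 2 * m * (e ^ 85)⁻¹ := by
          gcongr 2 * m * ?_
          rw [hpow, ← Real.rpow_neg hd0.le, ← Real.rpow_mul hd0.le]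
          refine Real.rpow_le_rpow_of_exponent_le hd1 ?_
          push_cast
          nlinarith
      _ = m * (4 * d / e ^ 65) / (2 * (d * e ^ 20)) := by
          field_simp
          ring
  · right
    push Not at hheavy
    refine exists_c4Free G (q := 2 * e / d) (m := d / e ^ 30) (t := 4 * d / e ^ 65)
      (by positivity) ((div_le_one hd0).2 (by nlinarith)) hd0 he0.le (by positivity)
      (by positivity) hdeg havg (fun u => (Nat.lt_ceil.1 (hmdef ▸ hheavy u)).le) ?_
    have key : e * (2 * e / d) + 2 * (d / e ^ 30 * (d * e ^ 20 * (2 * e / d) ^ 3 +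
        2 * (2 * e / d) ^ 2) + d * e ^ 20 * (d * e ^ 20) * (4 * d / e ^ 65) *
        (d * e ^ 20 * (2 * e / d) ^ 5 + 4 * (2 * e / d) ^ 4)) =
        e ^ 2 / d * (2 + 16 * (e ^ 9)⁻¹ + 16 * (e ^ 30)⁻¹ + 256 * (e ^ 2)⁻¹ +
          512 * (e ^ 23)⁻¹) := by
      field_simp
      ring
    have hrhs : d * (2 * e / d) ^ 2 = e ^ 2 / d * 4 := by
      field_simp
      ring
    have hinv : ∀ k, 2 ≤ k → (e ^ k)⁻¹ ≤ 1 / 441 := by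
      intro k hk
      rw [← one_div]
      refine one_div_le_one_div_of_le (by norm_num) ?_
      exact le_trans (by nlinarith) (pow_le_pow_right₀ (by linarith) hk)
    rw [key, hrhs]
    refine mul_lt_mul_of_pos_left ?_ (by positivity)
    have := hinv 9 (by norm_num)
    have := hinv 30 (by norm_num)
    have := hinv 2 (by norm_num)
    have := hinv 23 (by norm_num)
    linarith
end
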